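/- arXiv:1301.6047 — 3 statements merged into one kernel-verified Lean document; each statement's English description precedes it below -/
import Mathlib

section
/- Let E ⊆ {x₂ < 0} be a bounded open subset of ℝ² with Lipschitz boundary and let u be a solution of the Dirichlet problem associated with E. Then F(E, u) ≥ 0; equivalently ∫_ℝ u(x₁, 0) dx₁ ≤ |E|. -/
open MeasureTheory Set

noncomputable section

/-- The closed upper half-plane `{x₂ ≥ 0}`. -/
def upperHalf : Set (ℝ × ℝ) := {x : ℝ × ℝ | 0 ≤ x.2}

/-- The domain `D_E`: the interior of `closure(E) ∪ {x₂ ≥ 0}`. -/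
def domOf (E : Set (ℝ × ℝ)) : Set (ℝ × ℝ) := interior (closure E ∪ upperHalf)

/-- A solution of the Dirichlet problem associated with a bounded open set
`E ⊆ {x₂ < 0}`: a continuous function equal to `x₂⁻ = max(−x₂, 0)` outside `D_E`,
harmonic on `D_E`, and tending to `0` at infinity within `{x₂ ≥ 0}`. -/
structure DirichletSol (E : Set (ℝ × ℝ)) (u : ℝ × ℝ → ℝ) : Prop where
  cont : Continuous u
  eq_outside : ∀ x : ℝ × ℝ, x ∉ domOf E → u x = max (-x.2) 0
  smooth : ContDiffOn ℝ 2 u (domOf E)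
  harmonic : ∀ x ∈ domOf E,
    deriv (fun s => deriv (fun s' => u (s', x.2)) s) x.1
      + deriv (fun t => deriv (fun t' => u (x.1, t')) t) x.2 = 0
  decay : ∀ ε > (0:ℝ), ∃ R : ℝ, ∀ x : ℝ × ℝ, 0 ≤ x.2 →
    R ≤ Real.sqrt (x.1 ^ 2 + x.2 ^ 2) → |u x| ≤ ε

/-- The deficit functional `F(E, u) = |E| − ∫_ℝ u(x₁, 0) dx₁`. -/
def Ffun (E : Set (ℝ × ℝ)) (u : ℝ × ℝ → ℝ) : ℝ :=
  (volume E).toReal - ∫ x : ℝ, u (x, 0)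

/-- `E` has Lipschitz boundary: near each boundary point, after a rotation, `E`
coincides with the subgraph region of a Lipschitz function. -/
def HasLipschitzBoundary (E : Set (ℝ × ℝ)) : Prop :=
  ∀ p ∈ frontier E, ∃ ε > (0:ℝ), ∃ ν : ℝ × ℝ, ν.1 ^ 2 + ν.2 ^ 2 = 1 ∧
    ∃ g : ℝ → ℝ, ∃ K : NNReal, LipschitzWith K g ∧
      ∀ x ∈ Metric.ball p ε,
        (x ∈ E ↔ g (-(x.1 - p.1) * ν.2 + (x.2 - p.2) * ν.1)
          < (x.1 - p.1) * ν.1 + (x.2 - p.2) * ν.2)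


lemma exists_cutoff (ε : ℝ) (hε : 0 < ε) : ∃ ψ χ : ℝ → ℝ, Continuous χ ∧
    (∀ t, HasDerivAt ψ (χ t) t) ∧ (∀ t, 0 ≤ χ t) ∧ (∀ t, χ t ≤ 1) ∧
    (∀ t, t ≤ ε → χ t = 0) ∧ (∀ t, t ≤ ε → ψ t = 0) ∧ (∀ t, 0 ≤ ψ t) ∧
    (∀ t, t - 2 * ε ≤ ψ t) := by
  set χ : ℝ → ℝ := fun t => min 1 (max 0 (t / ε - 1)) with hχ
  have hc : Continuous χ := by fun_prop
  have h0 : ∀ t, 0 ≤ χ t := fun t => by simp [hχ]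
  have h1 : ∀ t, χ t ≤ 1 := fun t => by simp [hχ]
  have hz : ∀ t, t ≤ ε → χ t = 0 := by
    intro t ht
    have : t / ε - 1 ≤ 0 := by rw [sub_nonpos, div_le_one hε]; exact ht
    simp [hχ, max_eq_left this]
  have hone : ∀ t, 2 * ε ≤ t → χ t = 1 := by
    intro t ht
    have : 1 ≤ t / ε - 1 := by
      have : 2 ≤ t / ε := by rw [le_div_iff₀ hε]; exact ht
      linarith
    simp only [hχ]
    rw [min_eq_left]
    exact le_trans this (le_max_right _ _)
  have hii : ∀ a b, IntervalIntegrable χ volume a b := fun a b => hc.intervalIntegrable a b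
  have hneg : ∀ t, t ≤ ε → (∫ s in ε..t, χ s) = 0 := by
    intro t ht
    rw [intervalIntegral.integral_congr (g := fun _ => (0:ℝ))]
    · simp
    · intro s hs
      rw [uIcc_of_ge ht] at hs
      exact hz s hs.2
  have hnn : ∀ t, 0 ≤ ∫ s in ε..t, χ s := by
    intro t
    rcases le_total t ε with h | h
    · rw [hneg t h]
    · exact intervalIntegral.integral_nonneg h (fun s _ => h0 s)
  refine ⟨fun t => ∫ s in ε..t, χ s, χ, hc, ?_, h0, h1, hz, hneg, hnn, ?_⟩
  · intro t
    exact intervalIntegral.integral_hasDerivAt_right (hii _ _)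
      (hc.stronglyMeasurableAtFilter _ _) hc.continuousAt
  · intro t
    rcases le_total t (2 * ε) with h | h
    · have := hnn t; simp only; linarith
    · simp only
      rw [← intervalIntegral.integral_add_adjacent_intervals (hii ε (2*ε)) (hii (2*ε) t)]
      have e : (∫ s in (2*ε)..t, χ s) = t - 2 * ε := by
        rw [intervalIntegral.integral_congr (g := fun _ => (1:ℝ))]
        · simp
        · intro s hs
          rw [uIcc_of_le h] at hs
          exact hone s hs.1
      have := hnn (2*ε)
      linarith

lemma contOn_cut {D S : Set (ℝ × ℝ)} (hD : IsOpen D) {w k : ℝ × ℝ → ℝ} (hw : Continuous w)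
    (hk : ContinuousOn k D) {θ : ℝ → ℝ} (hθ : Continuous θ) {ε : ℝ} (hε : 0 < ε)
    (hz : ∀ t, t ≤ ε → θ t = 0) (hS : ∀ x ∈ S, x ∉ D → w x ≤ 0) :
    ContinuousOn (fun x => θ (w x) * k x) S := by
  intro x hx
  apply ContinuousAt.continuousWithinAt
  by_cases hxD : x ∈ D
  · exact (hθ.comp hw).continuousAt.mul (hk.continuousAt (hD.mem_nhds hxD))
  · have h : ∀ᶠ y in nhds x, w y < ε :=
      hw.continuousAt.eventually_lt continuousAt_const ((hS x hx hxD).trans_lt hε)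
    have : (fun x => θ (w x) * k x) =ᶠ[nhds x] fun _ => 0 := by
      filter_upwards [h] with y hy
      rw [hz _ hy.le, zero_mul]
    exact continuousAt_const.congr this.symm

lemma diffAt_cut {D : Set (ℝ × ℝ)} {w k : ℝ × ℝ → ℝ} {x : ℝ × ℝ} (hw : Continuous w)
    {w' k' : ℝ × ℝ →L[ℝ] ℝ} (hw' : x ∈ D → HasFDerivAt w w' x)
    (hk : x ∈ D → HasFDerivAt k k' x) {ψ χ : ℝ → ℝ} {ε : ℝ} (hε : 0 < ε)
    (hd : ∀ t, HasDerivAt ψ (χ t) t) (hz : ∀ t, t ≤ ε → ψ t = 0)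
    (hz' : ∀ t, t ≤ ε → χ t = 0) (hS : x ∉ D → w x ≤ 0) :
    HasFDerivAt (fun x => ψ (w x) * k x) (ψ (w x) • k' + k x • (χ (w x) • w')) x := by
  by_cases hxD : x ∈ D
  · exact ((hd (w x)).comp_hasFDerivAt x (hw' hxD)).mul (hk hxD)
  · have h : ∀ᶠ y in nhds x, w y < ε :=
      hw.continuousAt.eventually_lt continuousAt_const ((hS hxD).trans_lt hε)
    have : (fun x => ψ (w x) * k x) =ᶠ[nhds x] fun _ => 0 := by
      filter_upwards [h] with y hy
      rw [hz _ hy.le, zero_mul]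
    have e := (hS hxD).trans hε.le
    rw [hz _ e, hz' _ e]
    simpa using (hasFDerivAt_const (0:ℝ) x).congr_of_eventuallyEq this

/-- first derivatives -/
lemma partials {D : Set (ℝ × ℝ)} (hD : IsOpen D) {u : ℝ × ℝ → ℝ} (hu : ContDiffOn ℝ 2 u D)
    {p q : ℝ × ℝ → ℝ} (hp : p = fun x => deriv (fun s => u (s, x.2)) x.1)
    (hq : q = fun x => deriv (fun t => u (x.1, t)) x.2) :
    (∀ x ∈ D, HasFDerivAt u (p x • ContinuousLinearMap.fst ℝ ℝ ℝ
      + q x • ContinuousLinearMap.snd ℝ ℝ ℝ) x) ∧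
    (∀ x ∈ D, DifferentiableAt ℝ p x) ∧ (∀ x ∈ D, DifferentiableAt ℝ q x) := by
  have hdu : ∀ x ∈ D, DifferentiableAt ℝ u x := fun x hx =>
    (hu.contDiffAt (hD.mem_nhds hx)).differentiableAt (by norm_num)
  have hline1 : ∀ x : ℝ × ℝ, HasDerivAt (fun s : ℝ => (s, x.2)) ((1:ℝ), (0:ℝ)) x.1 := fun x =>
    (hasDerivAt_id _).prodMk (hasDerivAt_const _ _)
  have hline2 : ∀ x : ℝ × ℝ, HasDerivAt (fun s : ℝ => (x.1, s)) ((0:ℝ), (1:ℝ)) x.2 := fun x =>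
    (hasDerivAt_const _ _).prodMk (hasDerivAt_id _)
  have hpe : ∀ x ∈ D, p x = fderiv ℝ u x (1, 0) := fun x hx => by
    rw [hp]
    exact (HasFDerivAt.comp_hasDerivAt x.1 (f := fun s : ℝ => (s, x.2))
      (hdu x hx).hasFDerivAt (hline1 x)).deriv
  have hqe : ∀ x ∈ D, q x = fderiv ℝ u x (0, 1) := fun x hx => by
    rw [hq]
    exact (HasFDerivAt.comp_hasDerivAt x.2 (f := fun s : ℝ => (x.1, s))
      (hdu x hx).hasFDerivAt (hline2 x)).deriv
  have hdd : ∀ x ∈ D, DifferentiableAt ℝ (fderiv ℝ u) x := fun x hx =>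
    ((hu.contDiffAt (hD.mem_nhds hx)).fderiv_right (m := 1) (by norm_num)).differentiableAt
      (by norm_num)
  refine ⟨fun x hx => ?_, fun x hx => ?_, fun x hx => ?_⟩
  · convert (hdu x hx).hasFDerivAt using 1
    rw [hpe x hx, hqe x hx]
    ext <;> simp
  · refine ((hdd x hx).clm_apply (differentiableAt_const ((1:ℝ), (0:ℝ)))).congr_of_eventuallyEq ?_
    filter_upwards [hD.mem_nhds hx] with y hy using hpe y hy
  · refine ((hdd x hx).clm_apply (differentiableAt_const ((0:ℝ), (1:ℝ)))).congr_of_eventuallyEq ?_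
    filter_upwards [hD.mem_nhds hx] with y hy using hqe y hy

lemma partials2 {p : ℝ × ℝ → ℝ} {x : ℝ × ℝ} (h : DifferentiableAt ℝ p x) :
    fderiv ℝ p x (1, 0) = deriv (fun s => p (s, x.2)) x.1 ∧
    fderiv ℝ p x (0, 1) = deriv (fun s => p (x.1, s)) x.2 := by
  constructor
  · exact (HasFDerivAt.comp_hasDerivAt x.1 (f := fun s : ℝ => (s, x.2))
      h.hasFDerivAt ((hasDerivAt_id _).prodMk (hasDerivAt_const _ _))).deriv.symm
  · exact (HasFDerivAt.comp_hasDerivAt x.2 (f := fun s : ℝ => (x.1, s))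
      h.hasFDerivAt ((hasDerivAt_const _ _).prodMk (hasDerivAt_id _))).deriv.symm

lemma flux {D : Set (ℝ × ℝ)} (hD : IsOpen D) {u : ℝ × ℝ → ℝ} (hc : Continuous u)
    (hu : ContDiffOn ℝ 2 u D)
    {p q : ℝ × ℝ → ℝ} (hp : p = fun x => deriv (fun s => u (s, x.2)) x.1)
    (hq : q = fun x => deriv (fun t => u (x.1, t)) x.2)
    (hharm : ∀ x ∈ D, deriv (fun s => p (s, x.2)) x.1 + deriv (fun t => q (x.1, t)) x.2 = 0)
    {ψ χ : ℝ → ℝ} {ε : ℝ} (hε : 0 < ε) (hχc : Continuous χ)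
    (hd : ∀ t, HasDerivAt ψ (χ t) t) (hz : ∀ t, t ≤ ε → ψ t = 0)
    (hz' : ∀ t, t ≤ ε → χ t = 0) (α : ℝ) (A B : ℝ × ℝ) (hAB : A ≤ B)
    {w : ℝ × ℝ → ℝ} (hw : w = fun x => u x + α * x.2)
    (hS : ∀ x ∈ Icc A B, x ∉ D → w x ≤ 0) :
    ContinuousOn (fun x => χ (w x) * (p x ^ 2 + q x ^ 2 - α ^ 2)) (Icc A B) ∧
    ContinuousOn (fun x => ψ (w x) * q x) (Icc A B) ∧
    (∫ x in Icc A B, χ (w x) * (p x ^ 2 + q x ^ 2 - α ^ 2)) =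
      (((∫ x in A.1..B.1, ψ (w (x, B.2)) * (q (x, B.2) - α))
        - ∫ x in A.1..B.1, ψ (w (x, A.2)) * (q (x, A.2) - α)) +
          ∫ y in A.2..B.2, ψ (w (B.1, y)) * p (B.1, y)) -
        ∫ y in A.2..B.2, ψ (w (A.1, y)) * p (A.1, y) := by
  obtain ⟨h1, h2, h3⟩ := partials hD hu hp hq
  have hwc : Continuous w := by rw [hw]; fun_prop
  have hψc : Continuous ψ := continuous_iff_continuousAt.2 fun t => (hd t).continuousAt
  have hpc : ContinuousOn p D := fun x hx => (h2 x hx).continuousAt.continuousWithinAt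
  have hqc : ContinuousOn q D := fun x hx => (h3 x hx).continuousAt.continuousWithinAt
  set w' : ℝ × ℝ → ℝ × ℝ →L[ℝ] ℝ := fun x => p x • ContinuousLinearMap.fst ℝ ℝ ℝ
      + (q x + α) • ContinuousLinearMap.snd ℝ ℝ ℝ with hw'
  have hwd : ∀ x ∈ D, HasFDerivAt w (w' x) x := by
    intro x hx
    rw [hw]
    have := (h1 x hx).add (((ContinuousLinearMap.snd ℝ ℝ ℝ).hasFDerivAt (x := x)).const_mul α)
    have e : w' x = p x • ContinuousLinearMap.fst ℝ ℝ ℝ + q x • ContinuousLinearMap.snd ℝ ℝ ℝ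
        + α • ContinuousLinearMap.snd ℝ ℝ ℝ := by
      simp only [hw']; rw [add_smul, add_assoc]
    rw [e]
    exact this
  have hcd := contOn_cut hD hwc (k := fun x => p x ^ 2 + q x ^ 2 - α ^ 2) (by fun_prop) hχc hε hz' hS
  refine ⟨hcd, contOn_cut hD hwc hqc hψc hε hz hS, ?_⟩
  have key : ∀ x ∈ Icc A B,
      (ψ (w x) • fderiv ℝ p x + p x • (χ (w x) • w' x)) (1, 0) +
      (ψ (w x) • fderiv ℝ q x + (q x - α) • (χ (w x) • w' x)) (0, 1)
      = χ (w x) * (p x ^ 2 + q x ^ 2 - α ^ 2) := by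
    intro x hx
    by_cases hxD : x ∈ D
    · have e := hharm x hxD
      rw [← (partials2 (h2 x hxD)).1, ← (partials2 (h3 x hxD)).2] at e
      simp [hw']
      linear_combination ψ (w x) * e
    · have e := (hS x hx hxD).trans hε.le
      rw [hz _ e, hz' _ e]
      simp
  rw [← setIntegral_congr_fun measurableSet_Icc key]
  have hsub : ∀ x ∈ Ioo A.1 B.1 ×ˢ Ioo A.2 B.2, x ∈ Icc A B := fun x hx =>
    ⟨⟨hx.1.1.le, hx.2.1.le⟩, ⟨hx.1.2.le, hx.2.2.le⟩⟩
  refine integral_divergence_prod_Icc_of_hasFDerivAt_of_le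
    (fun x => ψ (w x) * p x) (fun x => ψ (w x) * (q x - α))
    (fun x => ψ (w x) • fderiv ℝ p x + p x • (χ (w x) • w' x))
    (fun x => ψ (w x) • fderiv ℝ q x + (q x - α) • (χ (w x) • w' x)) A B hAB ?_ ?_ ?_ ?_ ?_
  · exact contOn_cut hD hwc hpc hψc hε hz hS
  · exact contOn_cut hD hwc (k := fun x => q x - α) (by fun_prop) hψc hε hz hS
  · intro x hx
    exact diffAt_cut hwc (hwd x) (fun h => (h2 x h).hasFDerivAt) hε hd hz hz' (hS x (hsub x hx))
  · intro x hx
    exact diffAt_cut hwc (hwd x) (fun h => (h3 x h).hasFDerivAt.sub_const α) hε hd hz hz'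
      (hS x (hsub x hx))
  · rw [integrableOn_congr_fun key measurableSet_Icc]
    exact hcd.integrableOn_compact isCompact_Icc

lemma graph_null (g : ℝ → ℝ) (hg : Continuous g) :
    volume {y : ℝ × ℝ | g y.1 = y.2} = 0 := by
  have hm : MeasurableSet {y : ℝ × ℝ | g y.1 = y.2} :=
    (isClosed_eq (by fun_prop) (by fun_prop)).measurableSet
  rw [Measure.volume_eq_prod, Measure.measure_prod_null hm]
  refine Filter.Eventually.of_forall fun s => ?_
  have : Prod.mk s ⁻¹' {y : ℝ × ℝ | g y.1 = y.2} = {g s} := by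
    ext t; simp [eq_comm]
  simp [this]

lemma frontier_null {E : Set (ℝ × ℝ)} (hE : IsOpen E) (h : HasLipschitzBoundary E) :
    volume (frontier E) = 0 := by
  refine measure_null_of_locally_null _ fun x₀ hx₀ => ?_
  obtain ⟨ε, hε, ν, hν, g, K, hg, hb⟩ := h x₀ hx₀
  have hgc := hg.continuous
  let f : ℝ × ℝ →ₗ[ℝ] ℝ × ℝ :=
    { toFun := fun x => (-x.1 * ν.2 + x.2 * ν.1, x.1 * ν.1 + x.2 * ν.2)
      map_add' := by intro x y; ext <;> simp <;> ring
      map_smul' := by intro c x; ext <;> simp <;> ring }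
  have hf : ∀ x, f x = (-x.1 * ν.2 + x.2 * ν.1, x.1 * ν.1 + x.2 * ν.2) := fun x => rfl
  have hinj : Function.Injective f := by
    rw [injective_iff_map_eq_zero]
    intro x hx
    rw [hf, Prod.mk_eq_zero] at hx
    obtain ⟨a, b⟩ := hx
    ext
    · simp only [Prod.fst_zero]; linear_combination ν.1 * b - ν.2 * a - x.1 * hν
    · simp only [Prod.snd_zero]; linear_combination ν.2 * b + ν.1 * a - x.2 * hν
  have hdet : LinearMap.det f ≠ 0 := by
    have := (LinearEquiv.ofInjectiveEndo f hinj).isUnit_det'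
    exact this.ne_zero
  have hnull : volume ((fun x => x + -x₀) ⁻¹' (f ⁻¹' {y : ℝ × ℝ | g y.1 = y.2})) = 0 := by
    rw [measure_preimage_add_right, Measure.addHaar_preimage_linearMap _ hdet, graph_null g hgc,
      mul_zero]
  refine ⟨frontier E ∩ Metric.ball x₀ ε,
    inter_mem_nhdsWithin _ (Metric.ball_mem_nhds _ hε), measure_mono_null ?_ hnull⟩
  rintro x ⟨hx, hxb⟩
  simp only [mem_preimage, hf, mem_ofPred_eq]
  simp only [Prod.fst_add, Prod.snd_add, Prod.fst_neg, Prod.snd_neg, ← sub_eq_add_neg]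
  rw [hE.frontier_eq] at hx
  refine le_antisymm ?_ (not_lt.1 fun hlt => hx.2 ((hb x hxb).2 hlt))
  by_contra hlt
  push Not at hlt
  have hev : ∀ᶠ y : ℝ × ℝ in nhds x, (y.1 - x₀.1) * ν.1 + (y.2 - x₀.2) * ν.2 <
      g (-(y.1 - x₀.1) * ν.2 + (y.2 - x₀.2) * ν.1) :=
    ContinuousAt.eventually_lt (by fun_prop) (by fun_prop) hlt
  obtain ⟨y, hy, hyE⟩ := mem_closure_iff_nhds.1 hx.1 _
    (Filter.inter_mem hev (Metric.isOpen_ball.mem_nhds hxb))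
  exact absurd ((hb y hy.2).1 hyE) (not_lt.2 (le_of_lt hy.1))

lemma not_mem_dom {E : Set (ℝ × ℝ)} {x : ℝ × ℝ} (hx : x.2 ≤ 0) (hxE : x ∉ closure E) :
    x ∉ domOf E := by
  intro hD
  have h1 : domOf E ∩ (closure E)ᶜ ∈ nhds x :=
    Filter.inter_mem (isOpen_interior.mem_nhds hD) (isClosed_closure.isOpen_compl.mem_nhds hxE)
  have ht : Filter.Tendsto (fun δ : ℝ => (x.1, x.2 - δ)) (nhds 0) (nhds x) := by
    have : Continuous (fun δ : ℝ => (x.1, x.2 - δ)) := by fun_prop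
    simpa using this.tendsto 0
  obtain ⟨η, hη, hb⟩ := Metric.mem_nhds_iff.1 (ht h1)
  have hm : η / 2 ∈ Metric.ball (0:ℝ) η := by
    rw [Metric.mem_ball, dist_zero_right, Real.norm_eq_abs, abs_of_pos (by linarith)]; linarith
  have h2 := hb hm
  rcases interior_subset h2.1 with h | h
  · exact h2.2 h
  · have : (0:ℝ) ≤ x.2 - η / 2 := h
    linarith

lemma main_bound {E : Set (ℝ × ℝ)} (hEb : Bornology.IsBounded E)
    (hvol : volume (closure E) = volume E)
    {u : ℝ × ℝ → ℝ} (hu : DirichletSol E u) {r : ℝ} (hr : 0 < r)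
    (hEr : ∀ x ∈ closure E, ‖x‖ < r) {ε : ℝ} (hε : 0 < ε) :
    (∫ x in (-r)..r, u (x, 0)) ≤ (volume E).toReal + 4 * r * ε := by
  obtain ⟨ψ, χ, hχc, hd, hχ0, hχ1, hz', hz, hψ0, hψ2⟩ := exists_cutoff ε hε
  obtain ⟨R₁, hR₁⟩ := hu.decay ε hε
  set R := max r R₁ with hR
  have hrR : r ≤ R := le_max_left _ _
  have hR0 : 0 < R := hr.trans_le hrR
  have hψc : Continuous ψ := continuous_iff_continuousAt.2 fun t => (hd t).continuousAt
  have hD : IsOpen (domOf E) := isOpen_interior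
  set p : ℝ × ℝ → ℝ := fun x => deriv (fun s => u (s, x.2)) x.1 with hp
  set q : ℝ × ℝ → ℝ := fun x => deriv (fun t => u (x.1, t)) x.2 with hq
  have hharm : ∀ x ∈ domOf E,
      deriv (fun s => p (s, x.2)) x.1 + deriv (fun t => q (x.1, t)) x.2 = 0 := hu.harmonic
  -- far points in the closed lower half-plane
  have hfar : ∀ x : ℝ × ℝ, x.2 ≤ 0 → R ≤ ‖x‖ → u x + 1 * x.2 = 0 := by
    intro x hx hn
    have : x ∉ closure E := fun h => absurd (hEr x h) (not_lt.2 (hrR.trans hn))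
    rw [hu.eq_outside x (not_mem_dom hx this), max_eq_left (by linarith)]; ring
  -- vanishing in the upper box
  have hup : ∀ x : ℝ × ℝ, 0 ≤ x.2 → (R ≤ |x.1| ∨ R ≤ |x.2|) → ψ (u x + 0 * x.2) = 0 := by
    intro x hx hn
    apply hz
    rw [zero_mul, add_zero]
    refine (le_abs_self _).trans (hR₁ x hx ((le_max_right r R₁).trans ?_))
    apply Real.le_sqrt_of_sq_le
    rcases hn with h | h
    · nlinarith [sq_abs x.1, sq_nonneg x.2]
    · nlinarith [sq_abs x.2, sq_nonneg x.1]
  -- upper box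
  obtain ⟨cu, cq, iu⟩ := flux hD hu.cont hu.smooth hp hq hharm hε hχc hd hz hz' 0
    (-R, 0) (R, R) ⟨by simp; linarith, by simp; linarith⟩ rfl (by
      intro x hx hxD
      have : (0:ℝ) ≤ x.2 := hx.1.2
      simp only [hu.eq_outside x hxD]
      simp [this])
  have pu : 0 ≤ ∫ x in Icc ((-R, 0) : ℝ × ℝ) (R, R),
      χ (u x + 0 * x.2) * (p x ^ 2 + q x ^ 2 - 0 ^ 2) := by
    apply integral_nonneg
    intro x
    have := hχ0 (u x + 0 * x.2)
    simp only [Pi.zero_apply]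
    exact mul_nonneg this (by nlinarith [sq_nonneg (p x), sq_nonneg (q x)])
  have t1 : (∫ x in (-R)..R, ψ (u (x, R) + 0 * R) * (q (x, R) - 0)) = 0 := by
    rw [intervalIntegral.integral_congr (g := fun _ => (0:ℝ))]
    · simp
    · intro x _
      simp only
      rw [hup (x, R) hR0.le (Or.inr (le_abs_self _)), zero_mul]
  have t2 : (∫ y in (0:ℝ)..R, ψ (u (R, y) + 0 * y) * p (R, y)) = 0 := by
    rw [intervalIntegral.integral_congr (g := fun _ => (0:ℝ))]
    · simp
    · intro y hy
      rw [uIcc_of_le hR0.le] at hy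
      simp only
      rw [hup (R, y) hy.1 (Or.inl (le_abs_self _)), zero_mul]
  have t3 : (∫ y in (0:ℝ)..R, ψ (u (-R, y) + 0 * y) * p (-R, y)) = 0 := by
    rw [intervalIntegral.integral_congr (g := fun _ => (0:ℝ))]
    · simp
    · intro y hy
      rw [uIcc_of_le hR0.le] at hy
      simp only
      rw [hup (-R, y) hy.1 (Or.inl (by rw [abs_neg]; exact le_abs_self _)), zero_mul]
  simp only at iu
  rw [t1, t2, t3] at iu
  rw [iu] at pu
  -- lower box
  obtain ⟨cl, -, il⟩ := flux hD hu.cont hu.smooth hp hq hharm hε hχc hd hz hz' 1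
    (-R, -R) (R, 0) ⟨by simp; linarith, by simp; linarith⟩ rfl (by
      intro x hx hxD
      have : x.2 ≤ 0 := hx.2.2
      simp only [hu.eq_outside x hxD]
      rw [max_eq_left (by linarith)]; linarith)
  have s1 : (∫ x in (-R)..R, ψ (u (x, -R) + 1 * -R) * (q (x, -R) - 1)) = 0 := by
    rw [intervalIntegral.integral_congr (g := fun _ => (0:ℝ))]
    · simp
    · intro x _
      simp only
      rw [hfar (x, -R) (by simp; linarith)
        (le_trans (by simp [abs_of_pos hR0]) (norm_snd_le _)), hz _ hε.le, zero_mul]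
  have s2 : (∫ y in (-R)..0, ψ (u (R, y) + 1 * y) * p (R, y)) = 0 := by
    rw [intervalIntegral.integral_congr (g := fun _ => (0:ℝ))]
    · simp
    · intro y hy
      rw [uIcc_of_le (by linarith)] at hy
      simp only
      rw [hfar (R, y) hy.2
        (le_trans (by simp [abs_of_pos hR0]) (norm_fst_le _)), hz _ hε.le, zero_mul]
  have s3 : (∫ y in (-R)..0, ψ (u (-R, y) + 1 * y) * p (-R, y)) = 0 := by
    rw [intervalIntegral.integral_congr (g := fun _ => (0:ℝ))]
    · simp
    · intro y hy
      rw [uIcc_of_le (by linarith)] at hy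
      simp only
      rw [hfar (-R, y) hy.2
        (le_trans (by simp [abs_of_pos hR0]) (norm_fst_le _)), hz _ hε.le, zero_mul]
  simp only at il
  rw [s1, s2, s3] at il
  have hfin : volume (closure E) ≠ ⊤ := hEb.closure.measure_lt_top.ne
  have hmE : MeasurableSet (closure E) := isClosed_closure.measurableSet
  have pl : -(volume E).toReal ≤ ∫ x in Icc ((-R, -R) : ℝ × ℝ) (R, 0),
      χ (u x + 1 * x.2) * (p x ^ 2 + q x ^ 2 - 1 ^ 2) := by
    have hint : Integrable ((closure E).indicator fun _ => (-1:ℝ)) (volume : Measure (ℝ × ℝ)) :=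
      (integrable_indicator_iff hmE).2 (integrableOn_const hfin)
    calc -(volume E).toReal = ∫ x, (closure E).indicator (fun _ => (-1:ℝ)) x := by
            rw [integral_indicator hmE, setIntegral_const, measureReal_def, hvol]; simp
      _ ≤ ∫ x in Icc ((-R, -R) : ℝ × ℝ) (R, 0), (closure E).indicator (fun _ => (-1:ℝ)) x := by
            rw [← integral_indicator measurableSet_Icc]
            refine integral_mono hint (hint.indicator measurableSet_Icc) fun x => ?_
            have hi : (closure E).indicator (fun _ => (-1:ℝ)) x ≤ 0 :=
              indicator_nonpos (fun _ _ => by norm_num) x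
            by_cases hx : x ∈ Icc ((-R, -R) : ℝ × ℝ) (R, 0)
            · rw [indicator_of_mem hx]
            · rw [indicator_of_notMem hx]; exact hi
      _ ≤ _ := by
            refine setIntegral_mono_on hint.integrableOn (cl.integrableOn_compact isCompact_Icc)
              measurableSet_Icc fun x hx => ?_
            have h0 := hχ0 (u x + 1 * x.2)
            have h1 := hχ1 (u x + 1 * x.2)
            by_cases hxE : x ∈ closure E
            · rw [indicator_of_mem hxE]
              nlinarith [mul_nonneg h0 (add_nonneg (sq_nonneg (p x)) (sq_nonneg (q x)))]
            · rw [indicator_of_notMem hxE]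
              have h2 : x.2 ≤ 0 := hx.2.2
              have : u x + 1 * x.2 = 0 := by
                rw [hu.eq_outside x (not_mem_dom h2 hxE), max_eq_left (by linarith)]; ring
              rw [this, hz' _ hε.le, zero_mul]
  rw [il] at pl
  -- combine
  have cψ : Continuous fun x : ℝ => ψ (u (x, 0)) :=
    hψc.comp (hu.cont.comp (by fun_prop))
  have cq' : IntervalIntegrable (fun x : ℝ => ψ (u (x, 0)) * q (x, 0)) volume (-R) R := by
    apply ContinuousOn.intervalIntegrable
    rw [uIcc_of_le (by linarith)]
    have := cq.comp (f := fun x : ℝ => (x, (0:ℝ))) (s := Icc (-R) R) (by fun_prop)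
      (fun x hx => ⟨⟨hx.1, le_refl _⟩, ⟨hx.2, hR0.le⟩⟩)
    simpa [Function.comp_def] using this
  have spl : (∫ x in (-R)..R, ψ (u (x, 0)) * (q (x, 0) - 1)) =
      (∫ x in (-R)..R, ψ (u (x, 0)) * q (x, 0)) - ∫ x in (-R)..R, ψ (u (x, 0)) := by
    rw [← intervalIntegral.integral_sub cq' (cψ.intervalIntegrable _ _)]
    congr 1; ext x; ring
  simp only [mul_zero, add_zero, sub_zero, zero_sub] at pu pl
  rw [spl] at pl
  have m1 : (∫ x in (-r)..r, ψ (u (x, 0))) ≤ ∫ x in (-R)..R, ψ (u (x, 0)) :=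
    intervalIntegral.integral_mono_interval (by linarith) (by linarith) hrR
      (Filter.Eventually.of_forall fun x => hψ0 _) (cψ.intervalIntegrable _ _)
  have m2 : (∫ x in (-r)..r, u (x, 0)) ≤ ∫ x in (-r)..r, (ψ (u (x, 0)) + 2 * ε) := by
    apply intervalIntegral.integral_mono_on (by linarith)
    · exact (hu.cont.comp (by fun_prop : Continuous fun x : ℝ => (x, (0:ℝ)))).intervalIntegrable _ _
    · exact (cψ.add continuous_const).intervalIntegrable _ _
    · intro x _
      have := hψ2 (u (x, 0)); linarith
  rw [intervalIntegral.integral_add (cψ.intervalIntegrable _ _)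
    (continuous_const.intervalIntegrable _ _), intervalIntegral.integral_const, smul_eq_mul] at m2
  linarith

/-- Nonnegativity of the deficit: for a bounded open `E ⊆ {x₂ < 0}` with Lipschitz
boundary and `u` a solution of the associated Dirichlet problem,
`F(E, u) = |E| − ∫ u(x₁,0) dx₁ ≥ 0`. -/
theorem Ffun_nonneg (E : Set (ℝ × ℝ)) (hE : IsOpen E) (hEb : Bornology.IsBounded E)
    (hEsub : E ⊆ {x : ℝ × ℝ | x.2 < 0}) (hElip : HasLipschitzBoundary E)
    (u : ℝ × ℝ → ℝ) (hu : DirichletSol E u) :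
    0 ≤ Ffun E u := by
  obtain ⟨r, hr, hEr⟩ := hEb.closure.exists_pos_norm_lt
  have hvol : volume (closure E) = volume E :=
    measure_closure_of_null_frontier (frontier_null hE hElip)
  have hsupp : (∫ x in (-r)..r, u (x, 0)) = ∫ x, u (x, 0) := by
    apply intervalIntegral.integral_eq_integral_of_support_subset
    intro x hx
    by_contra hn
    apply hx
    have hxr : r ≤ |x| := by
      by_contra h
      push Not at h
      exact hn ⟨(abs_lt.1 h).1, (abs_lt.1 h).2.le⟩
    have : (x, (0:ℝ)) ∉ closure E := fun h => by
      have h1 := hEr _ h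
      have h2 := norm_fst_le (x, (0:ℝ))
      rw [Real.norm_eq_abs] at h2
      linarith
    simp [hu.eq_outside _ (not_mem_dom (le_refl (0:ℝ)) this)]
  rw [Ffun, ← hsupp, sub_nonneg]
  refine le_of_forall_pos_le_add fun δ hδ => ?_
  have := main_bound hEb hvol hu hr hEr (ε := δ / (4 * r)) (by positivity)
  rwa [mul_div_cancel₀ _ (by positivity)] at this
end
end

section
/- For c > 0 let A_c ⊂ ℝ² be the open isosceles triangle with vertices (−c, 0), (c, 0) and (0, −1). For any solution u of the Dirichlet problem associated with A_c one has F(A_c, u) ≤ 2; equivalently, ∫_ℝ u(x₁, 0) dx₁ ≥ c − 2. -/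
open MeasureTheory Set

noncomputable section

/-- The open isosceles triangle with vertices `(−c, 0)`, `(c, 0)` and `(0, −1)`. -/
def triangleA (c : ℝ) : Set (ℝ × ℝ) :=
  {x : ℝ × ℝ | -1 < x.2 ∧ x.2 < 0 ∧ |x.1| < c * (1 + x.2)}


open Filter Topology Function

/-- smooth cutoff -/
lemma exists_cutoff_s7 {K D : Set (ℝ × ℝ)} (hK : IsCompact K) (hD : IsOpen D) (hKD : K ⊆ D) :
    ∃ χ : ℝ × ℝ → ℝ, ContDiff ℝ 2 χ ∧ HasCompactSupport χ ∧ tsupport χ ⊆ D ∧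
      (∀ x, 0 ≤ χ x ∧ χ x ≤ 1) ∧ ∀ x ∈ K, χ x = 1 := by
  obtain ⟨K', hK', h1, h2⟩ := exists_compact_between hK hD hKD
  obtain ⟨f, f_diff, f_range, fs, ft⟩ := exists_contMDiff_support_eq_eq_one_iff (n := 2)
    (modelWithCornersSelf ℝ (ℝ × ℝ)) (isOpen_interior (s := K')) hK.isClosed h1
  have hts : tsupport f ⊆ K' := by
    rw [tsupport, fs]
    exact closure_minimal interior_subset hK'.isClosed
  refine ⟨f, f_diff.contDiff, ?_, hts.trans h2, ?_, fun x hx => (ft x).1 hx⟩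
  · exact hK'.of_isClosed_subset (isClosed_tsupport f) hts
  · intro x
    exact f_range ⟨x, rfl⟩

lemma cutoff_mul_contDiff {D : Set (ℝ × ℝ)} (hD : IsOpen D) {χ f : ℝ × ℝ → ℝ} {n : WithTop ℕ∞}
    (hχ : ContDiff ℝ n χ) (hχD : tsupport χ ⊆ D) (hf : ContDiffOn ℝ n f D) :
    ContDiff ℝ n (fun x => χ x * f x) := by
  rw [contDiff_iff_contDiffAt]
  intro x
  by_cases hx : x ∈ tsupport χ
  · exact hχ.contDiffAt.mul (hf.contDiffAt (hD.mem_nhds (hχD hx)))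
  · have h : χ =ᶠ[𝓝 x] fun _ => 0 := notMem_tsupport_iff_eventuallyEq.1 hx
    have h2 : (fun x => χ x * f x) =ᶠ[𝓝 x] fun _ => 0 := by
      filter_upwards [h] with y hy
      simp [hy]
    exact contDiffAt_const.congr_of_eventuallyEq h2

lemma lineDeriv_zero_of_notMem {ζ : ℝ × ℝ → ℝ} {x : ℝ × ℝ} (hx : x ∉ tsupport ζ) (e : ℝ × ℝ) :
    lineDeriv ℝ ζ x e = 0 := by
  have h : ζ =ᶠ[𝓝 x] fun _ => 0 := notMem_tsupport_iff_eventuallyEq.1 hx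
  rw [h.lineDeriv_eq]
  simp [lineDeriv]

lemma integrable_lineDeriv {ζ : ℝ × ℝ → ℝ} {C : NNReal} (hζ : LipschitzWith C ζ)
    (hc : HasCompactSupport ζ) (e : ℝ × ℝ) : Integrable (fun x => lineDeriv ℝ ζ x e) := by
  have h1 : IntegrableOn (fun x => lineDeriv ℝ ζ x e) (tsupport ζ) :=
    (hζ.locallyIntegrable_lineDeriv (μ := volume) e).integrableOn_isCompact hc
  refine (integrableOn_iff_integrable_of_support_subset ?_).1 h1
  intro x hx
  by_contra h
  exact hx (lineDeriv_zero_of_notMem h e)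

lemma integrable_lineDeriv_mul {ζ g : ℝ × ℝ → ℝ} {C : NNReal} (hζ : LipschitzWith C ζ)
    (hg : Integrable g) (e : ℝ × ℝ) : Integrable (fun x => lineDeriv ℝ ζ x e * g x) := by
  refine hg.bdd_mul (c := C * ‖e‖) ?_ ?_
  · exact aestronglyMeasurable_lineDeriv hζ.continuous volume
  · exact .of_forall fun _x => norm_lineDeriv_le_of_lipschitz ℝ hζ

lemma green_aux {D : Set (ℝ × ℝ)} (hD : IsOpen D) {p ζ : ℝ × ℝ → ℝ}
    (hp : ContDiffOn ℝ 1 p D) {C : NNReal} (hζ : LipschitzWith C ζ)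
    (hc : HasCompactSupport ζ) (hs : tsupport ζ ⊆ D) (e : ℝ × ℝ) :
    Integrable (fun x => lineDeriv ℝ ζ x e * p x) ∧
    Integrable (fun x => lineDeriv ℝ p x e * ζ x) ∧
    ∫ x, lineDeriv ℝ ζ x e * p x = - ∫ x, lineDeriv ℝ p x e * ζ x := by
  obtain ⟨χ, χd, χc, χs, -, χ1⟩ := exists_cutoff_s7 hc hD hs
  have hP : ContDiff ℝ 1 (fun x => χ x * p x) :=
    cutoff_mul_contDiff hD (χd.of_le (by norm_num)) χs hp
  have hPc : HasCompactSupport (fun x => χ x * p x) := χc.mul_right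
  obtain ⟨C', hP'⟩ := hP.lipschitzWith_of_hasCompactSupport hPc (by norm_num)
  have e1 : (fun x => lineDeriv ℝ ζ x e * p x) =
      fun x => lineDeriv ℝ ζ x e * (χ x * p x) := by
    funext x
    by_cases hx : x ∈ tsupport ζ
    · rw [χ1 x hx, one_mul]
    · rw [lineDeriv_zero_of_notMem hx]; ring
  have e2 : (fun x => lineDeriv ℝ p x e * ζ x) =
      fun x => lineDeriv ℝ (fun x => χ x * p x) x e * ζ x := by
    funext x
    by_cases hx : ζ x = 0
    · simp [hx]
    · have : (fun x => χ x * p x) =ᶠ[𝓝 x] p := by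
        have : ∀ᶠ y in 𝓝 x, ζ y ≠ 0 := hζ.continuous.continuousAt.eventually_ne hx
        filter_upwards [this] with y hy
        rw [χ1 y (subset_tsupport _ hy), one_mul]
      rw [this.lineDeriv_eq]
  refine ⟨?_, ?_, ?_⟩
  · rw [e1]
    exact integrable_lineDeriv_mul hζ (hP.continuous.integrable_of_hasCompactSupport hPc) e
  · rw [e2]
    exact integrable_lineDeriv_mul hP' (hζ.continuous.integrable_of_hasCompactSupport hc) e
  · rw [e1, e2, hP'.integral_lineDeriv_mul_eq (μ := volume) hζ hc e, ← integral_neg]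
    congr 1
    funext x
    rw [lineDeriv_neg]
    ring

lemma green {D : Set (ℝ × ℝ)} (hD : IsOpen D) {p q ζ : ℝ × ℝ → ℝ}
    (hp : ContDiffOn ℝ 1 p D) (hq : ContDiffOn ℝ 1 q D)
    (hdiv : ∀ x ∈ D, lineDeriv ℝ p x (1, 0) + lineDeriv ℝ q x (0, 1) = 0)
    {C : NNReal} (hζ : LipschitzWith C ζ)
    (hc : HasCompactSupport ζ) (hs : tsupport ζ ⊆ D) :
    Integrable (fun x => lineDeriv ℝ ζ x (1, 0) * p x) ∧
    Integrable (fun x => lineDeriv ℝ ζ x (0, 1) * q x) ∧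
    ∫ x, (lineDeriv ℝ ζ x (1, 0) * p x + lineDeriv ℝ ζ x (0, 1) * q x) = 0 := by
  obtain ⟨a1, a2, a3⟩ := green_aux hD hp hζ hc hs (1, 0)
  obtain ⟨b1, b2, b3⟩ := green_aux hD hq hζ hc hs (0, 1)
  refine ⟨a1, b1, ?_⟩
  rw [integral_add a1 b1, a3, b3, ← neg_add, ← integral_add a2 b2]
  rw [neg_eq_zero]
  apply integral_eq_zero_of_ae
  refine .of_forall fun x => ?_
  by_cases hx : x ∈ tsupport ζ
  · have := hdiv x (hs hx)
    simp only [Pi.zero_apply]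
    rw [← add_mul, this, zero_mul]
  · simp [image_eq_zero_of_notMem_tsupport hx]

lemma half_ftc {ζ : ℝ × ℝ → ℝ} {C : NNReal} (hζ : LipschitzWith C ζ)
    (hc : HasCompactSupport ζ) :
    Integrable (fun x : ℝ × ℝ => lineDeriv ℝ ζ x (0, 1) * (if 0 < x.2 then (1:ℝ) else 0)) ∧
    ∫ x : ℝ × ℝ, lineDeriv ℝ ζ x (0, 1) * (if 0 < x.2 then (1:ℝ) else 0)
      = - ∫ x : ℝ, ζ (x, 0) := by
  have hintg : Integrable
      (fun x : ℝ × ℝ => lineDeriv ℝ ζ x (0, 1) * (if 0 < x.2 then (1:ℝ) else 0)) := by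
    refine (integrable_lineDeriv hζ hc (0, 1)).mul_bdd (c := 1) ?_ ?_
    · refine (Measurable.ite ?_ measurable_const measurable_const).aestronglyMeasurable
      exact measurableSet_lt measurable_const measurable_snd
    · refine .of_forall fun x => ?_
      split_ifs <;> simp
  refine ⟨hintg, ?_⟩
  obtain ⟨R, hR⟩ := hc.isBounded.subset_closedBall 0
  have hz : ∀ x y : ℝ, R < y → ζ (x, y) = 0 := by
    intro x y hy
    by_contra h
    have := hR (subset_tsupport _ h)
    rw [mem_closedBall_zero_iff, Prod.norm_def] at this
    have h2 := (le_max_right _ _).trans this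
    have := le_abs_self y
    simp at h2
    linarith
  rw [Measure.volume_eq_prod, integral_prod _ (by rwa [Measure.volume_eq_prod] at hintg), ← integral_neg]
  congr 1
  funext x
  have hd : ∀ y, lineDeriv ℝ ζ (x, y) (0, 1) = deriv (fun t => ζ (x, t)) y := by
    intro y
    simp only [lineDeriv, Prod.smul_mk, smul_eq_mul, mul_zero, mul_one, Prod.mk_add_mk, add_zero]
    rw [deriv_comp_const_add (f := fun t => ζ (x, t))]
    simp
  have hl : LipschitzWith C (fun t => ζ (x, t)) := by
    have : LipschitzWith 1 (fun t : ℝ => (x, t)) := by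
      simpa using LipschitzWith.prodMk_left x
    have h := hζ.comp this
    rw [mul_one] at h
    exact h
  set M := max R 0 + 1 with hM
  have hM0 : 0 ≤ M := by positivity
  have hRM : R < M := by linarith [le_max_left R 0]
  have e1 : (fun y => lineDeriv ℝ ζ (x, y) (0, 1) * (if 0 < y then (1:ℝ) else 0)) =
      (Ioc 0 M).indicator (deriv (fun t => ζ (x, t))) := by
    funext y
    rw [hd, indicator]
    by_cases h1 : 0 < y
    · by_cases h2 : y ≤ M
      · simp [h1, h2]
      · have : (fun t => ζ (x, t)) =ᶠ[𝓝 y] fun _ => 0 := by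
          filter_upwards [lt_mem_nhds (show R < y by linarith)] with t ht using hz x t ht
        simp [h2, this.deriv_eq]
    · simp [h1]
  show ∫ y, lineDeriv ℝ ζ (x, y) (0, 1) * (if 0 < y then (1:ℝ) else 0) = _
  rw [e1, integral_indicator measurableSet_Ioc, ← intervalIntegral.integral_of_le hM0]
  rw [(hl.lipschitzOnWith (s := uIcc 0 M)).absolutelyContinuousOnInterval.integral_deriv_eq_sub, hz x M hRM]
  ring


lemma deriv2_nonneg_of_isLocalMin {f : ℝ → ℝ} {a : ℝ} (h : IsLocalMin f a)
    (hc : ContinuousAt f a) : 0 ≤ deriv (deriv f) a := by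
  by_contra! hneg
  have h2 := isLocalMax_of_deriv_deriv_neg hneg h.deriv_eq_zero hc
  have h3 : f =ᶠ[𝓝 a] fun _ => f a := by
    filter_upwards [h, h2] with x hx hx2
    exact le_antisymm hx2 hx
  have h4 : deriv f =ᶠ[𝓝 a] deriv (fun _ => f a) := h3.deriv
  rw [h4.deriv_eq] at hneg
  simp at hneg

lemma deriv2_ge {f : ℝ → ℝ} {a k η : ℝ} (hf : ContDiffAt ℝ 2 f a)
    (h : IsLocalMin (fun s => f s + k * s - η * s ^ 2) a) : 2 * η ≤ deriv (deriv f) a := by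
  have hc : ContinuousAt (fun s => f s + k * s - η * s ^ 2) a := by
    have := hf.continuousAt
    fun_prop
  have h1 := deriv2_nonneg_of_isLocalMin h hc
  have hd : ∀ᶠ s in 𝓝 a, DifferentiableAt ℝ f s := by
    have := hf.eventually (by simp)
    filter_upwards [this] with s hs
    exact hs.differentiableAt (by norm_num)
  have e1 : deriv (fun s => f s + k * s - η * s ^ 2) =ᶠ[𝓝 a]
      fun s => deriv f s + k - η * (2 * s) := by
    filter_upwards [hd] with s hs
    have h := (hs.hasDerivAt.add ((hasDerivAt_id s).const_mul k)).sub
      (((hasDerivAt_id s).pow 2).const_mul η)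
    have h' := h.deriv
    simp only [id, Nat.cast_ofNat] at h'
    refine Eq.trans ?_ (h'.trans ?_)
    · rfl
    · ring
  have hdd : DifferentiableAt ℝ (deriv f) a := by
    have : ContDiffAt ℝ 1 (deriv f) a := by
      have e : deriv f = fun s => fderiv ℝ f s 1 := by funext s; simp
      rw [e]
      exact (hf.fderiv_right (m := 1) (by norm_num)).clm_apply contDiffAt_const
    exact this.differentiableAt (by norm_num)
  rw [e1.deriv_eq] at h1
  have h3 := ((hdd.hasDerivAt.add_const k).sub (((hasDerivAt_id a).const_mul 2).const_mul η)).deriv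
  have h4 : deriv (fun s => deriv f s + k - η * (2 * s)) a = deriv (deriv f) a - η * (2 * 1) := h3
  rw [h4] at h1
  linarith

/-- weak minimum principle for `u + k x₂` -/
lemma min_principle {U : Set (ℝ × ℝ)} (hU : IsOpen U) {u : ℝ × ℝ → ℝ} (hu : Continuous u)
    (hC : ContDiffOn ℝ 2 u U)
    (hh : ∀ x ∈ U, deriv (fun s => deriv (fun s' => u (s', x.2)) s) x.1
      + deriv (fun t => deriv (fun t' => u (x.1, t')) t) x.2 = 0) (k : ℝ)
    (hK : ∀ ε > (0:ℝ), IsCompact {x | x ∈ U ∧ u x + k * x.2 ≤ -ε}) :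
    ∀ x ∈ U, 0 ≤ u x + k * x.2 := by
  intro x0 hx0
  by_contra! hneg
  set ε := -(u x0 + k * x0.2) / 2 with hε
  have hε0 : 0 < ε := by linarith
  have hcomp := hK ε hε0
  set K := {x | x ∈ U ∧ u x + k * x.2 ≤ -ε} with hKdef
  obtain ⟨R, hR0, hR⟩ : ∃ R : ℝ, 0 < R ∧ ∀ x ∈ K, x.1 ^ 2 ≤ R := by
    obtain ⟨R, hR⟩ := hcomp.bddAbove_image (f := fun x : ℝ × ℝ => x.1 ^ 2)
      (by fun_prop)
    refine ⟨max R 1, by positivity, fun x hx => ?_⟩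
    exact le_max_of_le_left (hR ⟨x, hx, rfl⟩)
  set η := ε / (2 * R) with hη
  have hη0 : 0 < η := by positivity
  have hηR : η * R = ε / 2 := by rw [hη]; field_simp
  have hx0K : x0 ∈ K := ⟨hx0, by linarith⟩
  obtain ⟨z, hzK, hz⟩ := hcomp.exists_isMinOn ⟨x0, hx0K⟩
    (f := fun x : ℝ × ℝ => u x + k * x.2 - η * x.1 ^ 2) (by fun_prop)
  have hz0 : u z + k * z.2 - η * z.1 ^ 2 ≤ u x0 + k * x0.2 - η * x0.1 ^ 2 := hz hx0K
  have hzlt : u z + k * z.2 < - ε := by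
    have h1 : η * z.1 ^ 2 ≤ η * R := mul_le_mul_of_nonneg_left (hR z hzK) hη0.le
    have h2 : 0 ≤ η * x0.1 ^ 2 := by positivity
    linarith
  have hnhds : K ∈ 𝓝 z := by
    have h1 : ∀ᶠ y in 𝓝 z, u y + k * y.2 < -ε :=
      (show Continuous fun y : ℝ × ℝ => u y + k * y.2 by fun_prop).continuousAt.eventually_lt
        continuousAt_const hzlt
    filter_upwards [h1, hU.mem_nhds hzK.1] with y h1 h2
    exact ⟨h2, h1.le⟩
  have hloc : IsLocalMin (fun x : ℝ × ℝ => u x + k * x.2 - η * x.1 ^ 2) z := by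
    filter_upwards [hnhds] with y hy using hz hy
  have hCz : ContDiffAt ℝ 2 u z := hC.contDiffAt (hU.mem_nhds hzK.1)
  have c1 : ContDiffAt ℝ 2 (fun s => u (s, z.2)) z.1 := by
    have : ContDiffAt ℝ 2 (fun s : ℝ => (s, z.2)) z.1 := by fun_prop
    exact ContDiffAt.comp z.1 (g := u) hCz this
  have c2 : ContDiffAt ℝ 2 (fun s => u (z.1, s)) z.2 := by
    have : ContDiffAt ℝ 2 (fun s : ℝ => (z.1, s)) z.2 := by fun_prop
    exact ContDiffAt.comp z.2 (g := u) hCz this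
  have l1 : IsLocalMin (fun s => u (s, z.2) + 0 * s - η * s ^ 2) z.1 := by
    have t : Tendsto (fun s : ℝ => (s, z.2)) (𝓝 z.1) (𝓝 z) :=
      (show Continuous fun s : ℝ => (s, z.2) by fun_prop).tendsto z.1
    filter_upwards [t.eventually hloc] with s hs
    have hs : u z + k * z.2 - η * z.1 ^ 2 ≤ u (s, z.2) + k * z.2 - η * s ^ 2 := hs
    show u z + 0 * z.1 - η * z.1 ^ 2 ≤ _
    linarith
  have l2 : IsLocalMin (fun s => u (z.1, s) + k * s - 0 * s ^ 2) z.2 := by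
    have t : Tendsto (fun s : ℝ => (z.1, s)) (𝓝 z.2) (𝓝 z) :=
      (show Continuous fun s : ℝ => (z.1, s) by fun_prop).tendsto z.2
    filter_upwards [t.eventually hloc] with s hs
    have hs : u z + k * z.2 - η * z.1 ^ 2 ≤ u (z.1, s) + k * s - η * z.1 ^ 2 := hs
    show u z + k * z.2 - 0 * z.2 ^ 2 ≤ _
    linarith
  have d1 := deriv2_ge c1 l1
  have d2 := deriv2_ge c2 l2
  have := hh z hzK.1
  have d1' : 2 * η ≤ deriv (fun s => deriv (fun s' => u (s', z.2)) s) z.1 := d1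
  have d2' : 2 * 0 ≤ deriv (fun t => deriv (fun t' => u (z.1, t')) t) z.2 := d2
  linarith


lemma isOpen_domOf (E : Set (ℝ × ℝ)) : IsOpen (domOf E) := isOpen_interior

lemma closure_tri {c : ℝ} : closure (triangleA c) ⊆
    {x : ℝ × ℝ | -1 ≤ x.2 ∧ x.2 ≤ 0 ∧ |x.1| ≤ c * (1 + x.2)} := by
  apply closure_minimal
  · rintro x ⟨h1, h2, h3⟩
    exact ⟨h1.le, h2.le, h3.le⟩
  · have e : {x : ℝ × ℝ | -1 ≤ x.2 ∧ x.2 ≤ 0 ∧ |x.1| ≤ c * (1 + x.2)} =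
        {x : ℝ × ℝ | -1 ≤ x.2} ∩ ({x : ℝ × ℝ | x.2 ≤ 0} ∩
          {x : ℝ × ℝ | |x.1| ≤ c * (1 + x.2)}) := by
      ext x
      rfl
    rw [e]
    refine (isClosed_le (by fun_prop) (by fun_prop)).inter
      ((isClosed_le (by fun_prop) (by fun_prop)).inter (isClosed_le (by fun_prop) (by fun_prop)))

lemma dom_lower {c : ℝ} {x : ℝ × ℝ} (hx : x ∈ domOf (triangleA c)) (h : x.2 < 0) :
    -1 ≤ x.2 ∧ |x.1| ≤ c * (1 + x.2) := by
  rcases interior_subset hx with h1 | h1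
  · have := closure_tri h1
    exact ⟨this.1, this.2.2⟩
  · exact absurd h (not_lt.2 h1)

lemma dom_upper {c : ℝ} {x : ℝ × ℝ} (h : 0 < x.2) : x ∈ domOf (triangleA c) := by
  refine mem_interior.2 ⟨{y | 0 < y.2}, ?_, isOpen_lt (by fun_prop) (by fun_prop), h⟩
  intro y hy
  have hy : 0 < y.2 := hy
  have hy' : y ∈ upperHalf := hy.le
  exact Or.inr hy'

lemma dom_psi {c : ℝ} (hc : 0 < c) {x : ℝ × ℝ}
    (h : 0 < 1 - |x.1| / c + min x.2 (-x.2 / c)) : x ∈ domOf (triangleA c) := by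
  refine mem_interior.2 ⟨{x | 0 < 1 - |x.1| / c + min x.2 (-x.2 / c)}, ?_,
    isOpen_lt (by fun_prop) (by fun_prop), h⟩
  intro y hy
  by_cases h0 : 0 ≤ y.2
  · exact Or.inr h0
  · left
    apply subset_closure
    push Not at h0
    have hy : 0 < 1 - |y.1| / c + min y.2 (-y.2 / c) := hy
    have h1 := min_le_left y.2 (-y.2 / c)
    have h2 : 0 ≤ |y.1| / c := by positivity
    have h3 : |y.1| / c < 1 + y.2 := by linarith
    rw [div_lt_iff₀ hc] at h3
    exact ⟨by linarith, h0, by linarith⟩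

lemma dom_axis {c : ℝ} (hc : 0 < c) {x : ℝ} (h : c ≤ |x|) : (x, (0:ℝ)) ∉ domOf (triangleA c) := by
  intro hx
  have hn := (isOpen_domOf (triangleA c)).mem_nhds hx
  have t : Tendsto (fun s : ℝ => (x, -s)) (𝓝 0) (𝓝 (x, (0:ℝ))) := by
    have : Continuous (fun s : ℝ => (x, -s)) := by fun_prop
    simpa using this.tendsto 0
  have h1 : ∀ᶠ s in 𝓝[>] (0:ℝ), (x, -s) ∈ domOf (triangleA c) :=
    (t.eventually hn).filter_mono nhdsWithin_le_nhds
  obtain ⟨s, hs, hs0⟩ := (h1.and self_mem_nhdsWithin).exists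
  have hs0 : 0 < s := hs0
  have := (dom_lower hs (by simpa using hs0)).2
  simp only at this
  nlinarith

lemma compact_aux {c R : ℝ} {S : Set (ℝ × ℝ)} (hc : 0 < c) (hS : IsClosed S)
    (h1 : ∀ x ∈ S, x.2 < 0 → x ∈ domOf (triangleA c))
    (h2 : ∀ x ∈ S, 0 ≤ x.2 → Real.sqrt (x.1 ^ 2 + x.2 ^ 2) ≤ R) : IsCompact S := by
  refine (isCompact_closedBall (0 : ℝ × ℝ) (max (max c 1) R)).of_isClosed_subset hS ?_
  intro x hx
  rw [mem_closedBall_zero_iff, Prod.norm_def, Real.norm_eq_abs, Real.norm_eq_abs]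
  by_cases h : x.2 < 0
  · obtain ⟨a, b⟩ := dom_lower (h1 x hx h) h
    apply max_le
    · exact le_max_of_le_left (le_max_of_le_left (by nlinarith))
    · exact le_max_of_le_left (le_max_of_le_right (by rw [abs_le]; constructor <;> linarith))
  · have := h2 x hx (not_lt.1 h)
    apply max_le
    · exact le_max_of_le_right ((Real.abs_le_sqrt (by nlinarith [sq_nonneg x.2])).trans this)
    · exact le_max_of_le_right ((Real.abs_le_sqrt (by nlinarith [sq_nonneg x.1])).trans this)

/-- `v = u - x₂⁻`. -/
def vfun (u : ℝ × ℝ → ℝ) (x : ℝ × ℝ) : ℝ := u x + x.2 - max x.2 0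

lemma vfun_cont {E : Set (ℝ × ℝ)} {u : ℝ × ℝ → ℝ} (hu : DirichletSol E u) :
    Continuous (vfun u) := by
  have := hu.cont
  unfold vfun
  fun_prop

lemma vfun_zero {E : Set (ℝ × ℝ)} {u : ℝ × ℝ → ℝ} (hu : DirichletSol E u) {x : ℝ × ℝ}
    (hx : x ∉ domOf E) : vfun u x = 0 := by
  rw [vfun, hu.eq_outside x hx]
  rcases le_total x.2 0 with h | h
  · rw [max_eq_left (by linarith), max_eq_right h]; ring
  · rw [max_eq_right (by linarith), max_eq_left h]; ring

lemma w_nonneg {c : ℝ} (hc : 0 < c) {u : ℝ × ℝ → ℝ} (hu : DirichletSol (triangleA c) u)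
    (x : ℝ × ℝ) : 0 ≤ u x + x.2 := by
  have hout : ∀ x ∉ domOf (triangleA c), 0 ≤ u x + x.2 := by
    intro x hx
    rw [hu.eq_outside x hx]
    linarith [le_max_left (-x.2) 0]
  by_cases hx : x ∈ domOf (triangleA c)
  swap
  · exact hout x hx
  have := min_principle (isOpen_domOf _) hu.cont hu.smooth hu.harmonic 1 ?_ x hx
  · linarith
  intro ε hε
  obtain ⟨R, hR⟩ := hu.decay (ε / 2) (by linarith)
  refine compact_aux (R := R) hc ?_ (fun x hx _ => hx.1) ?_
  · have : {x | x ∈ domOf (triangleA c) ∧ u x + 1 * x.2 ≤ -ε} = {x | u x + 1 * x.2 ≤ -ε} := by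
      ext x
      simp only [mem_ofPred_eq, and_iff_right_iff_imp]
      intro h
      by_contra h'
      have := hout x h'
      linarith
    rw [this]
    have := hu.cont
    exact isClosed_le (by fun_prop) (by fun_prop)
  · rintro x ⟨h1, h2⟩ h3
    by_contra! h
    have := neg_le_of_abs_le (hR x h3 h.le)
    linarith

lemma u_nonneg {c : ℝ} (hc : 0 < c) {u : ℝ × ℝ → ℝ} (hu : DirichletSol (triangleA c) u)
    (x : ℝ × ℝ) (hx : 0 ≤ x.2) : 0 ≤ u x := by
  have h0 : ∀ x : ℝ × ℝ, x.2 = 0 → 0 ≤ u x := by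
    intro x hx
    have := w_nonneg hc hu x
    linarith
  rcases hx.eq_or_lt with hx | hx
  · exact h0 x hx.symm
  have hsub : {x : ℝ × ℝ | 0 < x.2} ⊆ domOf (triangleA c) := fun x hx => dom_upper hx
  have := min_principle (U := {x : ℝ × ℝ | 0 < x.2}) (isOpen_lt (by fun_prop) (by fun_prop))
    hu.cont (hu.smooth.mono hsub) (fun x hx => hu.harmonic x (hsub hx)) 0 ?_ x hx
  · linarith
  intro ε hε
  obtain ⟨R, hR⟩ := hu.decay (ε / 2) (by linarith)
  refine compact_aux (R := R) hc ?_ (fun x hx _ => hsub hx.1) ?_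
  · have : {x : ℝ × ℝ | x ∈ {x : ℝ × ℝ | 0 < x.2} ∧ u x + 0 * x.2 ≤ -ε} =
        {x | 0 ≤ x.2} ∩ {x | u x + 0 * x.2 ≤ -ε} := by
      ext x
      simp only [mem_ofPred_eq, mem_inter_iff]
      constructor
      · rintro ⟨h1, h2⟩
        exact ⟨h1.le, h2⟩
      · rintro ⟨h1, h2⟩
        refine ⟨lt_of_le_of_ne h1 ?_, h2⟩
        intro h
        have := h0 x h.symm
        linarith
    rw [this]
    have := hu.cont
    exact (isClosed_le (by fun_prop) (by fun_prop)).inter (isClosed_le (by fun_prop) (by fun_prop))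
  · rintro x ⟨h1, h2⟩ h3
    by_contra! h
    have := neg_le_of_abs_le (hR x h3 h.le)
    linarith

lemma vfun_nonneg {c : ℝ} (hc : 0 < c) {u : ℝ × ℝ → ℝ} (hu : DirichletSol (triangleA c) u)
    (x : ℝ × ℝ) : 0 ≤ vfun u x := by
  unfold vfun
  rcases le_total x.2 0 with h | h
  · rw [max_eq_right h]
    have := w_nonneg hc hu x
    linarith
  · rw [max_eq_left h]
    have := u_nonneg hc hu x h
    linarith

lemma vfun_compact {c : ℝ} (hc : 0 < c) {u : ℝ × ℝ → ℝ} (hu : DirichletSol (triangleA c) u)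
    {ε : ℝ} (hε : 0 < ε) : IsCompact {x | ε ≤ vfun u x} ∧
      {x | ε ≤ vfun u x} ⊆ domOf (triangleA c) := by
  have hsub : {x | ε ≤ vfun u x} ⊆ domOf (triangleA c) := by
    intro x hx
    by_contra h
    have h1 := vfun_zero hu h
    have hx : ε ≤ vfun u x := hx
    linarith
  refine ⟨?_, hsub⟩
  obtain ⟨R, hR⟩ := hu.decay (ε / 2) (by linarith)
  refine compact_aux (R := R) hc ?_ (fun x hx _ => hsub hx) ?_
  · exact isClosed_le continuous_const (vfun_cont hu)
  · intro x hx h3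
    by_contra! h
    have h1 := le_of_abs_le (hR x h3 h.le)
    have hx : ε ≤ vfun u x := hx
    rw [vfun, max_eq_left h3] at hx
    linarith

/-- partial derivatives of `w = u + x₂`. -/
def pfun (u : ℝ × ℝ → ℝ) (x : ℝ × ℝ) : ℝ := deriv (fun s => u (s, x.2)) x.1
/-- partial derivatives of `w = u + x₂`. -/
def qfun (u : ℝ × ℝ → ℝ) (x : ℝ × ℝ) : ℝ := deriv (fun t => u (x.1, t)) x.2 + 1

lemma lineDeriv_e1 (f : ℝ × ℝ → ℝ) (x : ℝ × ℝ) :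
    lineDeriv ℝ f x (1, 0) = deriv (fun s => f (s, x.2)) x.1 := by
  obtain ⟨a, b⟩ := x
  simp only [lineDeriv, Prod.smul_mk, smul_eq_mul, mul_zero, mul_one, Prod.mk_add_mk, add_zero]
  rw [deriv_comp_const_add (f := fun t => f (t, b))]
  simp

lemma lineDeriv_e2 (f : ℝ × ℝ → ℝ) (x : ℝ × ℝ) :
    lineDeriv ℝ f x (0, 1) = deriv (fun s => f (x.1, s)) x.2 := by
  obtain ⟨a, b⟩ := x
  simp only [lineDeriv, Prod.smul_mk, smul_eq_mul, mul_zero, mul_one, Prod.mk_add_mk, add_zero]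
  rw [deriv_comp_const_add (f := fun t => f (a, t))]
  simp

lemma pq_facts {E : Set (ℝ × ℝ)} {u : ℝ × ℝ → ℝ} (hu : DirichletSol E u) :
    ContDiffOn ℝ 1 (pfun u) (domOf E) ∧ ContDiffOn ℝ 1 (qfun u) (domOf E) ∧
    ∀ x ∈ domOf E, lineDeriv ℝ (pfun u) x (1, 0) + lineDeriv ℝ (qfun u) x (0, 1) = 0 := by
  have hd : ∀ x ∈ domOf E, DifferentiableAt ℝ u x := fun x hx =>
    (hu.smooth.contDiffAt ((isOpen_domOf E).mem_nhds hx)).differentiableAt (by norm_num)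
  have hf : ContDiffOn ℝ 1 (fderiv ℝ u) (domOf E) :=
    hu.smooth.fderiv_of_isOpen (isOpen_domOf E) (by norm_num)
  refine ⟨?_, ?_, ?_⟩
  · refine (hf.clm_apply (contDiffOn_const (c := ((1:ℝ), (0:ℝ))))).congr fun x hx => ?_
    rw [pfun, ← lineDeriv_e1, (hd x hx).lineDeriv_eq_fderiv]
  · refine ((hf.clm_apply (contDiffOn_const (c := ((0:ℝ), (1:ℝ))))).add
      (contDiffOn_const (c := (1:ℝ)))).congr fun x hx => ?_
    rw [qfun, ← lineDeriv_e2, (hd x hx).lineDeriv_eq_fderiv]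
  · intro x hx
    rw [lineDeriv_e1, lineDeriv_e2]
    have := hu.harmonic x hx
    simp only [pfun, qfun, deriv_add_const]
    exact this


lemma lineDeriv_zero_of_min {f : ℝ × ℝ → ℝ} {x : ℝ × ℝ} (h : ∀ y, f x ≤ f y) (e : ℝ × ℝ) :
    lineDeriv ℝ f x e = 0 := by
  rw [lineDeriv]
  apply IsLocalMin.deriv_eq_zero
  refine .of_forall fun t => ?_
  simpa using h _

lemma v_lineDeriv {E : Set (ℝ × ℝ)} {u : ℝ × ℝ → ℝ} (hu : DirichletSol E u) {x : ℝ × ℝ}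
    (hx : x ∈ domOf E) (h2 : x.2 ≠ 0) :
    lineDeriv ℝ (vfun u) x (1, 0) = pfun u x ∧
    lineDeriv ℝ (vfun u) x (0, 1) = qfun u x - (if 0 < x.2 then (1:ℝ) else 0) := by
  have hd : DifferentiableAt ℝ u x :=
    (hu.smooth.contDiffAt ((isOpen_domOf E).mem_nhds hx)).differentiableAt (by norm_num)
  rcases lt_or_gt_of_ne h2 with h | h
  · have ev : vfun u =ᶠ[𝓝 x] fun y => u y + y.2 := by
      have : ∀ᶠ y : ℝ × ℝ in 𝓝 x, y.2 < 0 :=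
        continuous_snd.continuousAt.eventually_lt continuousAt_const h
      filter_upwards [this] with y hy
      rw [vfun, max_eq_right hy.le, sub_zero]
    rw [ev.lineDeriv_eq, ev.lineDeriv_eq, lineDeriv_e1, lineDeriv_e2]
    refine ⟨by simp [pfun], ?_⟩
    have hs : DifferentiableAt ℝ (fun s => u (x.1, s)) x.2 := by
      have : DifferentiableAt ℝ (fun s : ℝ => (x.1, s)) x.2 := by fun_prop
      exact DifferentiableAt.comp x.2 (g := u) hd this
    have h3 := (hs.hasDerivAt.add (hasDerivAt_id x.2)).deriv
    rw [if_neg (not_lt.2 h.le), sub_zero, qfun, ← h3]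
    rfl
  · have ev : vfun u =ᶠ[𝓝 x] u := by
      have : ∀ᶠ y : ℝ × ℝ in 𝓝 x, 0 < y.2 :=
        continuousAt_const.eventually_lt continuous_snd.continuousAt h
      filter_upwards [this] with y hy
      rw [vfun, max_eq_left hy.le]; ring
    rw [ev.lineDeriv_eq, ev.lineDeriv_eq, lineDeriv_e1, lineDeriv_e2, if_pos h, qfun, pfun]
    exact ⟨rfl, by ring⟩

/-- truncation of `v` -/
def zfun (u : ℝ × ℝ → ℝ) (ε : ℝ) (x : ℝ × ℝ) : ℝ := max (vfun u x - ε) 0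

lemma zfun_lip {c : ℝ} (hc : 0 < c) {u : ℝ × ℝ → ℝ} (hu : DirichletSol (triangleA c) u)
    {ε : ℝ} (hε : 0 < ε) : (∃ C : NNReal, LipschitzWith C (zfun u ε)) ∧
      HasCompactSupport (zfun u ε) ∧ tsupport (zfun u ε) ⊆ domOf (triangleA c) := by
  obtain ⟨hK, hKD⟩ := vfun_compact hc hu hε
  have hts : tsupport (zfun u ε) ⊆ {x | ε ≤ vfun u x} := by
    apply closure_minimal _ hK.isClosed
    intro x hx
    show ε ≤ vfun u x
    by_contra! h
    exact hx (max_eq_right (by linarith))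
  refine ⟨?_, hK.of_isClosed_subset (isClosed_tsupport _) hts, hts.trans hKD⟩
  obtain ⟨χ, χd, χc, χs, χr, χ1⟩ := exists_cutoff_s7 hK (isOpen_domOf _) hKD
  have hW : ContDiff ℝ 2 (fun x : ℝ × ℝ => χ x * (u x + x.2)) :=
    cutoff_mul_contDiff (f := fun x => u x + x.2) (isOpen_domOf _) χd χs
      (hu.smooth.add contDiff_snd.contDiffOn)
  obtain ⟨C, hC⟩ := hW.lipschitzWith_of_hasCompactSupport χc.mul_right (by norm_num)
  have hm : LipschitzWith 1 (fun x : ℝ × ℝ => max x.2 0) :=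
    LipschitzWith.prod_snd.max_const 0
  refine ⟨C + 1 + 0, ?_⟩
  have := ((hC.sub hm).sub (LipschitzWith.const ε)).max_const 0
  have e : zfun u ε = fun x => max ((χ * fun x : ℝ × ℝ => u x + x.2) x - max x.2 0 - ε) 0 := ?_
  · rw [e]
    exact this
  funext x
  simp only [zfun]
  by_cases hx : ε ≤ vfun u x
  · have h1 := χ1 x hx
    simp [h1, vfun]
  · push Not at hx
    rw [max_eq_right (by linarith)]
    symm
    apply max_eq_right
    have h1 := w_nonneg hc hu x
    have h2 : χ x * (u x + x.2) ≤ u x + x.2 := mul_le_of_le_one_left h1 (χr x).2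
    rw [vfun] at hx
    simp only [Pi.mul_apply]
    linarith

lemma zfun_lineDeriv {u : ℝ × ℝ → ℝ} (hv : Continuous (vfun u)) (ε : ℝ) (x e : ℝ × ℝ) :
    lineDeriv ℝ (zfun u ε) x e = if ε < vfun u x then lineDeriv ℝ (vfun u) x e else 0 := by
  split_ifs with h
  · have : zfun u ε =ᶠ[𝓝 x] fun y => vfun u y - ε := by
      have : ∀ᶠ y in 𝓝 x, ε < vfun u y :=
        continuousAt_const.eventually_lt hv.continuousAt h
      filter_upwards [this] with y hy
      exact max_eq_left (by linarith)
    rw [this.lineDeriv_eq]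
    simp [lineDeriv]
  · apply lineDeriv_zero_of_min
    intro y
    rw [zfun, max_eq_right (by linarith)]
    exact le_max_right _ _

lemma ae_snd_ne : ∀ᵐ x : ℝ × ℝ, x.2 ≠ 0 := by
  have h : ∀ᵐ y : ℝ, y ≠ 0 := by simp [ae_iff]
  exact Measure.quasiMeasurePreserving_snd.ae h

lemma u_axis_integrable {c : ℝ} (hc : 0 < c) {u : ℝ × ℝ → ℝ}
    (hu : DirichletSol (triangleA c) u) : Integrable (fun x : ℝ => u (x, 0)) := by
  have h := hu.cont
  apply Continuous.integrable_of_hasCompactSupport (by fun_prop)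
  apply HasCompactSupport.of_support_subset_isCompact (isCompact_Icc (a := -c) (b := c))
  intro x hx
  by_contra h'
  have : c ≤ |x| := by
    by_contra! h2
    exact h' (abs_le.1 h2.le)
  apply hx
  show u (x, 0) = 0
  rw [hu.eq_outside _ (dom_axis hc this)]
  simp

lemma axis_integrable {ζ : ℝ × ℝ → ℝ} (h : Continuous ζ) (hc : HasCompactSupport ζ) :
    Integrable (fun x : ℝ => ζ (x, 0)) := by
  apply Continuous.integrable_of_hasCompactSupport (by fun_prop)
  apply HasCompactSupport.of_support_subset_isCompact (hc.image continuous_fst)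
  intro x hx
  exact ⟨(x, 0), subset_tsupport _ hx, rfl⟩

/-- Green identity against `v`. -/
lemma green_v {E : Set (ℝ × ℝ)} {u : ℝ × ℝ → ℝ} (hu : DirichletSol E u) {ζ : ℝ × ℝ → ℝ}
    {C : NNReal} (hζ : LipschitzWith C ζ)
    (hc : HasCompactSupport ζ) (hs : tsupport ζ ⊆ domOf E) :
    Integrable (fun x : ℝ × ℝ => lineDeriv ℝ ζ x (1, 0) * pfun u x +
      lineDeriv ℝ ζ x (0, 1) * (qfun u x - (if 0 < x.2 then (1:ℝ) else 0))) ∧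
    ∫ x : ℝ × ℝ, (lineDeriv ℝ ζ x (1, 0) * pfun u x +
      lineDeriv ℝ ζ x (0, 1) * (qfun u x - (if 0 < x.2 then (1:ℝ) else 0))) =
      ∫ x : ℝ, ζ (x, 0) := by
  obtain ⟨hp, hq, hpq⟩ := pq_facts hu
  obtain ⟨a1, a2, a3⟩ := green (isOpen_domOf E) hp hq hpq hζ hc hs
  obtain ⟨b1, b2⟩ := half_ftc hζ hc
  have e : (fun x : ℝ × ℝ => lineDeriv ℝ ζ x (1, 0) * pfun u x +
      lineDeriv ℝ ζ x (0, 1) * (qfun u x - (if 0 < x.2 then (1:ℝ) else 0))) =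
      fun x : ℝ × ℝ => (lineDeriv ℝ ζ x (1, 0) * pfun u x + lineDeriv ℝ ζ x (0, 1) * qfun u x) -
        lineDeriv ℝ ζ x (0, 1) * (if 0 < x.2 then (1:ℝ) else 0) := by
    funext x; ring
  rw [e]
  refine ⟨(a1.add a2).sub b1, ?_⟩
  have hab : Integrable (fun x : ℝ × ℝ =>
      lineDeriv ℝ ζ x (1, 0) * pfun u x + lineDeriv ℝ ζ x (0, 1) * qfun u x) := a1.add a2
  rw [integral_sub hab b1, a3, b2]
  ring

lemma energy_eps {c : ℝ} (hc : 0 < c) {u : ℝ × ℝ → ℝ} (hu : DirichletSol (triangleA c) u)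
    {φ : ℝ × ℝ → ℝ} {C : NNReal} (hφ : LipschitzWith C φ) (hφc : HasCompactSupport φ)
    (t : ℝ) {ε : ℝ} (hε : 0 < ε) :
    2 * t * ∫ x in {x | ε < vfun u x}, (lineDeriv ℝ φ x (1, 0) * pfun u x +
      lineDeriv ℝ φ x (0, 1) * (qfun u x - (if 0 < x.2 then (1:ℝ) else 0))) ≤
    (∫ x : ℝ, u (x, 0)) + t ^ 2 *
      ∫ x : ℝ × ℝ, (lineDeriv ℝ φ x (1, 0) ^ 2 + lineDeriv ℝ φ x (0, 1) ^ 2) := by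
  obtain ⟨⟨C', hζ⟩, hζc, hζs⟩ := zfun_lip hc hu hε
  obtain ⟨g1, g2⟩ := green_v hu hζ hζc hζs
  set ζ := zfun u ε with hζdef
  have hv := vfun_cont hu
  have hin : ∀ x, ε < vfun u x → x ∈ domOf (triangleA c) := fun x hx =>
    (vfun_compact hc hu hε).2 (show ε ≤ vfun u x from hx.le)
  -- energy of ζ
  have i1 : Integrable (fun x => lineDeriv ℝ ζ x (1, 0) ^ 2 + lineDeriv ℝ ζ x (0, 1) ^ 2) := by
    simp only [pow_two]
    exact (integrable_lineDeriv_mul hζ (integrable_lineDeriv hζ hζc _) _).add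
      (integrable_lineDeriv_mul hζ (integrable_lineDeriv hζ hζc _) _)
  have i2 : Integrable (fun x => lineDeriv ℝ φ x (1, 0) ^ 2 + lineDeriv ℝ φ x (0, 1) ^ 2) := by
    simp only [pow_two]
    exact (integrable_lineDeriv_mul hφ (integrable_lineDeriv hφ hφc _) _).add
      (integrable_lineDeriv_mul hφ (integrable_lineDeriv hφ hφc _) _)
  have i3 : Integrable (fun x => lineDeriv ℝ ζ x (1, 0) * lineDeriv ℝ φ x (1, 0) +
      lineDeriv ℝ ζ x (0, 1) * lineDeriv ℝ φ x (0, 1)) :=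
    (integrable_lineDeriv_mul hζ (integrable_lineDeriv hφ hφc _) _).add
      (integrable_lineDeriv_mul hζ (integrable_lineDeriv hφ hφc _) _)
  have hI : ∫ x, (lineDeriv ℝ ζ x (1, 0) ^ 2 + lineDeriv ℝ ζ x (0, 1) ^ 2) ≤
      ∫ x : ℝ, u (x, 0) := by
    have : ∫ x, (lineDeriv ℝ ζ x (1, 0) ^ 2 + lineDeriv ℝ ζ x (0, 1) ^ 2) =
        ∫ x : ℝ, ζ (x, 0) := by
      rw [← g2]
      apply integral_congr_ae
      filter_upwards [ae_snd_ne] with x hx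
      rw [hζdef, zfun_lineDeriv hv, zfun_lineDeriv hv]
      split_ifs with h1 h2
      · obtain ⟨k1, k2⟩ := v_lineDeriv hu (hin x h1) hx
        rw [if_pos h2] at k2
        rw [k1, k2]; ring
      · obtain ⟨k1, k2⟩ := v_lineDeriv hu (hin x h1) hx
        rw [if_neg h2] at k2
        rw [k1, k2]; ring
      · ring
      · ring
    rw [this]
    apply integral_mono (axis_integrable hζ.continuous hζc) (u_axis_integrable hc hu)
    intro x
    have h := u_nonneg hc hu (x, 0) le_rfl
    show max (vfun u (x, 0) - ε) 0 ≤ u (x, 0)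
    apply max_le _ h
    simp [vfun, hε.le]
  have hJ : ∫ x in {x | ε < vfun u x}, (lineDeriv ℝ φ x (1, 0) * pfun u x +
      lineDeriv ℝ φ x (0, 1) * (qfun u x - (if 0 < x.2 then (1:ℝ) else 0))) =
      ∫ x, (lineDeriv ℝ ζ x (1, 0) * lineDeriv ℝ φ x (1, 0) +
      lineDeriv ℝ ζ x (0, 1) * lineDeriv ℝ φ x (0, 1)) := by
    rw [← integral_indicator (measurableSet_lt measurable_const hv.measurable)]
    apply integral_congr_ae
    filter_upwards [ae_snd_ne] with x hx
    rw [hζdef, zfun_lineDeriv hv, zfun_lineDeriv hv]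
    by_cases h1 : ε < vfun u x
    · rw [indicator_of_mem (show x ∈ {x | ε < vfun u x} from h1)]
      obtain ⟨k1, k2⟩ := v_lineDeriv hu (hin x h1) hx
      rw [if_pos h1, if_pos h1, k1, k2]; ring
    · rw [indicator_of_notMem (show x ∉ {x | ε < vfun u x} from h1)]
      rw [if_neg h1, if_neg h1]; ring
  rw [hJ]
  have hpos : 0 ≤ ∫ x, ((lineDeriv ℝ ζ x (1, 0) ^ 2 + lineDeriv ℝ ζ x (0, 1) ^ 2) +
      t ^ 2 * (lineDeriv ℝ φ x (1, 0) ^ 2 + lineDeriv ℝ φ x (0, 1) ^ 2) -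
      2 * t * (lineDeriv ℝ ζ x (1, 0) * lineDeriv ℝ φ x (1, 0) +
      lineDeriv ℝ ζ x (0, 1) * lineDeriv ℝ φ x (0, 1))) := by
    apply integral_nonneg
    intro x
    simp only [Pi.zero_apply]
    nlinarith [sq_nonneg (lineDeriv ℝ ζ x (1, 0) - t * lineDeriv ℝ φ x (1, 0)),
      sq_nonneg (lineDeriv ℝ ζ x (0, 1) - t * lineDeriv ℝ φ x (0, 1))]
  have i12 : Integrable (fun x => (lineDeriv ℝ ζ x (1, 0) ^ 2 + lineDeriv ℝ ζ x (0, 1) ^ 2) +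
      t ^ 2 * (lineDeriv ℝ φ x (1, 0) ^ 2 + lineDeriv ℝ φ x (0, 1) ^ 2)) :=
    i1.add (i2.const_mul _)
  rw [integral_sub i12 (i3.const_mul _), integral_add i1 (i2.const_mul _),
    integral_const_mul, integral_const_mul] at hpos
  linarith

lemma energy_ineq {c : ℝ} (hc : 0 < c) {u : ℝ × ℝ → ℝ} (hu : DirichletSol (triangleA c) u)
    {φ : ℝ × ℝ → ℝ} {C : NNReal} (hφ : LipschitzWith C φ) (hφc : HasCompactSupport φ)
    (hφs : tsupport φ ⊆ domOf (triangleA c)) (t : ℝ) :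
    2 * t * ∫ x : ℝ, φ (x, 0) ≤ (∫ x : ℝ, u (x, 0)) + t ^ 2 *
      ∫ x : ℝ × ℝ, (lineDeriv ℝ φ x (1, 0) ^ 2 + lineDeriv ℝ φ x (0, 1) ^ 2) := by
  obtain ⟨g1, g2⟩ := green_v hu hφ hφc hφs
  have hv := vfun_cont hu
  have hU : (⋃ n : ℕ, {x | 1 / ((n:ℝ) + 1) < vfun u x}) = {x | 0 < vfun u x} := by
    ext x
    simp only [mem_iUnion]
    constructor
    · rintro ⟨n, hn⟩
      have hn : 1 / ((n:ℝ) + 1) < vfun u x := hn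
      exact lt_trans (by positivity) hn
    · intro h
      have h : 0 < vfun u x := h
      exact exists_nat_one_div_lt h
  have hlim := tendsto_setIntegral_of_monotone (μ := volume)
    (s := fun n : ℕ => {x | 1 / ((n:ℝ) + 1) < vfun u x})
    (fun n => measurableSet_lt measurable_const hv.measurable) ?_ (g1.integrableOn)
  · rw [hU] at hlim
    have hfull : ∫ x in {x | 0 < vfun u x}, (lineDeriv ℝ φ x (1, 0) * pfun u x +
      lineDeriv ℝ φ x (0, 1) * (qfun u x - (if 0 < x.2 then (1:ℝ) else 0))) =
      ∫ x : ℝ, φ (x, 0) := by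
      rw [← g2, ← integral_indicator (measurableSet_lt measurable_const hv.measurable)]
      apply integral_congr_ae
      filter_upwards [ae_snd_ne] with x hx
      by_cases h1 : 0 < vfun u x
      · rw [indicator_of_mem (show x ∈ {x | 0 < vfun u x} from h1)]
      · rw [indicator_of_notMem (show x ∉ {x | 0 < vfun u x} from h1)]
        by_cases hs : x ∈ tsupport φ
        · obtain ⟨k1, k2⟩ := v_lineDeriv hu (hφs hs) hx
          have hmin : ∀ y, vfun u x ≤ vfun u y := fun y =>
            (not_lt.1 h1).trans (vfun_nonneg hc hu y)
          rw [lineDeriv_zero_of_min hmin] at k1 k2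
          rw [← k1, ← k2]; ring
        · rw [lineDeriv_zero_of_notMem hs, lineDeriv_zero_of_notMem hs]; ring
    rw [hfull] at hlim
    refine le_of_tendsto (hlim.const_mul (2 * t)) (.of_forall fun n => ?_)
    exact energy_eps hc hu hφ hφc t (by positivity)
  · intro m n hmn x hx
    have hx : 1 / ((m:ℝ) + 1) < vfun u x := hx
    show 1 / ((n:ℝ) + 1) < vfun u x
    refine lt_of_le_of_lt ?_ hx
    have : (m:ℝ) ≤ n := by exact_mod_cast hmn
    gcongr


/-- the piecewise linear test function before truncation -/
def psif (c : ℝ) (x : ℝ × ℝ) : ℝ := 1 - |x.1| / c + min x.2 (-x.2 / c)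

/-- the truncated test function -/
def phif (c δ : ℝ) (x : ℝ × ℝ) : ℝ := max (psif c x - δ) 0

lemma psif_cont (c : ℝ) : Continuous (psif c) := by
  unfold psif
  fun_prop

lemma phif_lip {c δ : ℝ} (hc : 0 < c) : ∃ C : NNReal, LipschitzWith C (phif c δ) := by
  have hs : 0 < c⁻¹ := by positivity
  refine ⟨Real.toNNReal (1 + 2 * c⁻¹), LipschitzWith.of_le_add_mul _ fun x y => ?_⟩
  rw [Real.coe_toNNReal _ (by positivity)]
  set d := dist x y with hd
  have hd0 : 0 ≤ d := dist_nonneg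
  have d1 : |x.1 - y.1| ≤ d := by
    rw [hd, Prod.dist_eq]; exact le_max_left _ _
  have d2 : |x.2 - y.2| ≤ d := by
    rw [hd, Prod.dist_eq]; exact le_max_right _ _
  have hk : 0 ≤ c⁻¹ * d := by positivity
  have h1 : |y.1| * c⁻¹ ≤ |x.1| * c⁻¹ + c⁻¹ * d := by
    have := abs_sub_abs_le_abs_sub y.1 x.1
    rw [abs_sub_comm] at this
    nlinarith
  have h2 := abs_le.1 d2
  have h3 : psif c x ≤ psif c y + (1 + 2 * c⁻¹) * d := by
    unfold psif
    simp only [div_eq_mul_inv]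
    have : min x.2 (-x.2 * c⁻¹) ≤ min y.2 (-y.2 * c⁻¹) + (d + c⁻¹ * d) := by
      rw [← min_add_add_right]
      apply min_le_min
      · linarith
      · nlinarith
    linarith
  unfold phif
  have hp : 0 ≤ (1 + 2 * c⁻¹) * d := by positivity
  apply max_le
  · linarith [le_max_left (psif c y - δ) 0]
  · linarith [le_max_right (psif c y - δ) 0]

lemma phif_supp {c δ : ℝ} (hc : 0 < c) (hδ : 0 < δ) : HasCompactSupport (phif c δ) ∧
    tsupport (phif c δ) ⊆ domOf (triangleA c) := by
  have hcl : IsClosed {x | δ ≤ psif c x} := isClosed_le continuous_const (psif_cont c)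
  have hsub : {x | δ ≤ psif c x} ⊆ domOf (triangleA c) := by
    intro x hx
    have hx : δ ≤ psif c x := hx
    exact dom_psi hc (lt_of_lt_of_le hδ hx)
  have hts : tsupport (phif c δ) ⊆ {x | δ ≤ psif c x} := by
    apply closure_minimal _ hcl
    intro x hx
    show δ ≤ psif c x
    by_contra! h
    exact hx (max_eq_right (by linarith))
  refine ⟨?_, hts.trans hsub⟩
  have hK : IsCompact {x | δ ≤ psif c x} := by
    refine compact_aux (R := Real.sqrt (c ^ 2 + c ^ 2)) hc hcl (fun x hx _ => hsub hx) ?_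
    intro x hx h0
    have hx : δ ≤ 1 - |x.1| / c + min x.2 (-x.2 / c) := hx
    have h1 := min_le_right x.2 (-x.2 / c)
    have h2 : |x.1| / c + x.2 / c ≤ 1 := by
      have : -x.2 / c = - (x.2 / c) := by ring
      linarith
    rw [← add_div, div_le_one hc] at h2
    have h3 := abs_nonneg x.1
    apply Real.sqrt_le_sqrt
    have h4 : x.1 ^ 2 ≤ c ^ 2 := by
      rw [← sq_abs x.1]
      exact pow_le_pow_left₀ h3 (by linarith) 2
    have h5 : x.2 ^ 2 ≤ c ^ 2 := pow_le_pow_left₀ h0 (by linarith) 2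
    linarith
  exact hK.of_isClosed_subset (isClosed_tsupport _) hts

lemma phif_diff_le (c δ : ℝ) (x y : ℝ × ℝ) :
    |phif c δ x - phif c δ y| ≤ |psif c x - psif c y| := by
  unfold phif
  refine (abs_max_sub_max_le_abs _ _ _).trans (le_of_eq ?_)
  congr 1; ring

lemma phif_e1 {c δ : ℝ} (hc : 0 < c) (x : ℝ × ℝ) :
    lineDeriv ℝ (phif c δ) x (1, 0) ^ 2 ≤ 1 / c ^ 2 := by
  rw [lineDeriv_e1]
  have : ‖deriv (fun s => phif c δ (s, x.2)) x.1‖ ≤ 1 / c := by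
    apply norm_deriv_le_of_lip' (by positivity)
    refine .of_forall fun s => ?_
    rw [Real.norm_eq_abs, Real.norm_eq_abs]
    refine (phif_diff_le c δ _ _).trans ?_
    have : psif c (s, x.2) - psif c (x.1, x.2) = (|x.1| - |s|) / c := by
      simp only [psif]; ring
    rw [this, abs_div, abs_of_pos hc, div_eq_inv_mul, one_div]
    refine mul_le_mul_of_nonneg_left ?_ (by positivity)
    rw [abs_sub_comm s]
    exact abs_abs_sub_abs_le x.1 s
  rw [Real.norm_eq_abs] at this
  rw [← sq_abs, show 1 / c ^ 2 = (1 / c) ^ 2 by ring]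
  exact pow_le_pow_left₀ (abs_nonneg _) this 2

lemma phif_e2_neg {c δ : ℝ} (hc : 0 < c) (x : ℝ × ℝ) (hx : x.2 < 0) :
    lineDeriv ℝ (phif c δ) x (0, 1) ^ 2 ≤ 1 := by
  rw [lineDeriv_e2]
  have hm : ∀ s : ℝ, s < 0 → psif c (x.1, s) = 1 - |x.1| / c + s := by
    intro s hs
    simp only [psif]
    rw [min_eq_left]
    have : 0 < -s / c := div_pos (by linarith) hc
    linarith
  have : ‖deriv (fun s => phif c δ (x.1, s)) x.2‖ ≤ 1 := by
    apply norm_deriv_le_of_lip' (by positivity)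
    filter_upwards [gt_mem_nhds hx] with s hs
    rw [Real.norm_eq_abs, Real.norm_eq_abs]
    refine (phif_diff_le c δ _ _).trans ?_
    rw [hm s hs, hm x.2 hx]
    apply le_of_eq
    rw [one_mul]; congr 1; ring
  rw [Real.norm_eq_abs] at this
  rw [← sq_abs]
  exact pow_le_one₀ (abs_nonneg _) this

lemma phif_e2_pos {c δ : ℝ} (hc : 0 < c) (x : ℝ × ℝ) (hx : 0 < x.2) :
    lineDeriv ℝ (phif c δ) x (0, 1) ^ 2 ≤ 1 / c ^ 2 := by
  rw [lineDeriv_e2]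
  have hm : ∀ s : ℝ, 0 < s → psif c (x.1, s) = 1 - |x.1| / c + -s / c := by
    intro s hs
    simp only [psif]
    rw [min_eq_right]
    have : -s / c < 0 := div_neg_of_neg_of_pos (by linarith) hc
    linarith
  have : ‖deriv (fun s => phif c δ (x.1, s)) x.2‖ ≤ 1 / c := by
    apply norm_deriv_le_of_lip' (by positivity)
    filter_upwards [lt_mem_nhds hx] with s hs
    rw [Real.norm_eq_abs, Real.norm_eq_abs]
    refine (phif_diff_le c δ _ _).trans ?_
    rw [hm s hs, hm x.2 hx]
    apply le_of_eq
    rw [show 1 - |x.1| / c + -s / c - (1 - |x.1| / c + -x.2 / c) = -((s - x.2) / c) by ring,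
      abs_neg, abs_div, abs_of_pos hc]
    ring
  rw [Real.norm_eq_abs] at this
  rw [← sq_abs, show 1 / c ^ 2 = (1 / c) ^ 2 by ring]
  exact pow_le_pow_left₀ (abs_nonneg _) this 2

lemma integral_abs_Ioo {c : ℝ} (hc : 0 < c) : ∫ x in Ioo (-c) c, |x| = c ^ 2 := by
  rw [← integral_Ioc_eq_integral_Ioo, ← intervalIntegral.integral_of_le (by linarith)]
  have hi : ∀ a b : ℝ, IntervalIntegrable (fun x : ℝ => |x|) volume a b :=
    fun a b => continuous_abs.intervalIntegrable a b
  rw [← intervalIntegral.integral_add_adjacent_intervals (hi (-c) 0) (hi 0 c)]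
  have e1 : ∫ x in (-c)..0, |x| = ∫ x in (-c)..0, -x := by
    apply intervalIntegral.integral_congr
    intro x hx
    rw [uIcc_of_le (by linarith)] at hx
    exact abs_of_nonpos hx.2
  have e2 : ∫ x in (0:ℝ)..c, |x| = ∫ x in (0:ℝ)..c, x := by
    apply intervalIntegral.integral_congr
    intro x hx
    rw [uIcc_of_le hc.le] at hx
    exact abs_of_nonneg hx.1
  rw [e1, e2, intervalIntegral.integral_neg, integral_id, integral_id]
  ring

lemma integral_tent {c : ℝ} (hc : 0 < c) (a b : ℝ) :
    ∫ x in Ioo (-c) c, (a - b * |x|) = 2 * c * a - b * c ^ 2 := by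
  have h1 : IntegrableOn (fun x : ℝ => b * |x|) (Ioo (-c) c) :=
    ((continuous_const.mul continuous_abs).integrableOn_Icc (a := -c) (b := c)).mono_set
      Ioo_subset_Icc_self
  have h2 : IntegrableOn (fun _ : ℝ => a) (Ioo (-c) c) :=
    (continuous_const.integrableOn_Icc (a := -c) (b := c)).mono_set Ioo_subset_Icc_self
  rw [integral_sub h2 h1, integral_const_mul, integral_abs_Ioo hc]
  simp only [integral_const, smul_eq_mul]
  have : (volume.restrict (Ioo (-c) c)).real univ = 2 * c := by
    rw [measureReal_restrict_apply_univ, Real.volume_real_Ioo_of_le (by linarith)]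
    ring
  rw [this]

lemma vol_tri {c : ℝ} (hc : 0 < c) : volume (triangleA c) = ENNReal.ofReal c := by
  have e : triangleA c = regionBetween (fun x => |x| / c - 1) (fun _ => 0) (Ioo (-c) c) := by
    ext x
    constructor
    · rintro ⟨h1, h2, h3⟩
      refine ⟨abs_lt.1 (by nlinarith), ?_, h2⟩
      show |x.1| / c - 1 < x.2
      have : |x.1| / c < 1 + x.2 := by rw [div_lt_iff₀ hc]; linarith
      linarith
    · rintro ⟨h1, h2, h3⟩
      have h2 : |x.1| / c - 1 < x.2 := h2
      have h4 : 0 ≤ |x.1| / c := by positivity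
      have : |x.1| / c < 1 + x.2 := by linarith
      rw [div_lt_iff₀ hc] at this
      exact ⟨by linarith, h3, by linarith⟩
  rw [e, Measure.volume_eq_prod, volume_regionBetween_eq_integral]
  · congr 1
    have := integral_tent hc 1 (1 / c)
    rw [show 2 * c * 1 - 1 / c * c ^ 2 = c by field_simp; ring] at this
    refine Eq.trans ?_ this
    congr 1
    funext x
    simp only [Pi.sub_apply]
    ring
  · exact ((show Continuous fun x : ℝ => |x| / c - 1 by fun_prop).integrableOn_Icc
      (a := -c) (b := c)).mono_set Ioo_subset_Icc_self
  · exact ((show Continuous fun _ : ℝ => (0:ℝ) by fun_prop).integrableOn_Icc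
      (a := -c) (b := c)).mono_set Ioo_subset_Icc_self
  · exact measurableSet_Ioo
  · intro x hx
    have : |x| / c ≤ 1 := by
      rw [div_le_one hc]; exact (abs_lt.2 hx).le
    linarith

lemma vol_up {c : ℝ} (hc : 0 < c) :
    volume (regionBetween (fun _ => 0) (fun x => c - |x|) (Ioo (-c) c)) =
      ENNReal.ofReal (c ^ 2) := by
  rw [Measure.volume_eq_prod, volume_regionBetween_eq_integral]
  · congr 1
    have := integral_tent hc c 1
    rw [show 2 * c * c - 1 * c ^ 2 = c ^ 2 by ring] at this
    rw [← this]
    congr 1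
    funext x
    simp only [Pi.sub_apply]
    ring
  · exact ((show Continuous fun _ : ℝ => (0:ℝ) by fun_prop).integrableOn_Icc
      (a := -c) (b := c)).mono_set Ioo_subset_Icc_self
  · exact ((show Continuous fun x : ℝ => c - |x| by fun_prop).integrableOn_Icc
      (a := -c) (b := c)).mono_set Ioo_subset_Icc_self
  · exact measurableSet_Ioo
  · intro x hx
    have := (abs_lt.2 hx).le
    linarith

lemma phif_energy {c δ : ℝ} (hc : 0 < c) (hδ : 0 < δ) :
    ∫ x : ℝ × ℝ, (lineDeriv ℝ (phif c δ) x (1, 0) ^ 2 + lineDeriv ℝ (phif c δ) x (0, 1) ^ 2) ≤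
      c + 1 / c + 2 := by
  set L := triangleA c with hL
  set W := regionBetween (fun _ => 0) (fun x => c - |x|) (Ioo (-c) c) with hW
  have mL : MeasurableSet L := by
    have : L = {x : ℝ × ℝ | -1 < x.2} ∩ ({x : ℝ × ℝ | x.2 < 0} ∩
        {x : ℝ × ℝ | |x.1| < c * (1 + x.2)}) := by
      ext x; rfl
    rw [this]
    exact ((isOpen_lt (by fun_prop) (by fun_prop)).inter
      ((isOpen_lt (by fun_prop) (by fun_prop)).inter
        (isOpen_lt (by fun_prop) (by fun_prop)))).measurableSet
  have mW : MeasurableSet W := measurableSet_regionBetween (by fun_prop) (by fun_prop)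
    measurableSet_Ioo
  have vL : volume L = ENNReal.ofReal c := vol_tri hc
  have vW : volume W = ENNReal.ofReal (c ^ 2) := vol_up hc
  have iL : Integrable (L.indicator (fun _ : ℝ × ℝ => 1 / c ^ 2 + 1)) := by
    rw [integrable_indicator_iff mL]
    exact integrableOn_const (by rw [vL]; exact ENNReal.ofReal_ne_top)
  have iW : Integrable (W.indicator (fun _ : ℝ × ℝ => 2 / c ^ 2)) := by
    rw [integrable_indicator_iff mW]
    exact integrableOn_const (by rw [vW]; exact ENNReal.ofReal_ne_top)
  have hle : ∫ x : ℝ × ℝ, (lineDeriv ℝ (phif c δ) x (1, 0) ^ 2 +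
        lineDeriv ℝ (phif c δ) x (0, 1) ^ 2) ≤
      ∫ x, (L.indicator (fun _ : ℝ × ℝ => 1 / c ^ 2 + 1) x +
        W.indicator (fun _ : ℝ × ℝ => 2 / c ^ 2) x) := by
    obtain ⟨C, hC⟩ := phif_lip (δ := δ) hc
    have hcs := (phif_supp hc hδ).1
    apply integral_mono_ae
    · simp only [pow_two]
      exact (integrable_lineDeriv_mul hC (integrable_lineDeriv hC hcs _) _).add
        (integrable_lineDeriv_mul hC (integrable_lineDeriv hC hcs _) _)
    · exact iL.add iW
    · filter_upwards [ae_snd_ne] with x hx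
      have hcc : 0 < 1 / c ^ 2 := by positivity
      have n1 : 0 ≤ L.indicator (fun _ : ℝ × ℝ => 1 / c ^ 2 + 1) x :=
        indicator_nonneg (fun _ _ => by positivity) x
      have n2 : 0 ≤ W.indicator (fun _ : ℝ × ℝ => 2 / c ^ 2) x :=
        indicator_nonneg (fun _ _ => by positivity) x
      by_cases hp : psif c x ≤ δ
      · have hmin : ∀ y, phif c δ x ≤ phif c δ y := by
          intro y
          rw [phif, max_eq_right (by linarith)]
          exact le_max_right _ _
        rw [lineDeriv_zero_of_min hmin, lineDeriv_zero_of_min hmin]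
        nlinarith
      · push Not at hp
        have hp : δ < 1 - |x.1| / c + min x.2 (-x.2 / c) := hp
        have k1 := min_le_left x.2 (-x.2 / c)
        have k2 := min_le_right x.2 (-x.2 / c)
        have k3 : 0 ≤ |x.1| / c := by positivity
        have e1 := phif_e1 (δ := δ) hc x
        rcases lt_or_gt_of_ne hx with h | h
        · have hmem : x ∈ L := by
            have : |x.1| / c < 1 + x.2 := by linarith
            rw [div_lt_iff₀ hc] at this
            exact ⟨by linarith, h, by linarith⟩
          have e2 := phif_e2_neg (δ := δ) hc x h
          rw [indicator_of_mem hmem]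
          linarith
        · have hmem : x ∈ W := by
            have : |x.1| / c + x.2 / c < 1 := by
              have : -x.2 / c = -(x.2 / c) := by ring
              linarith
            rw [← add_div, div_lt_one hc] at this
            refine ⟨abs_lt.1 (by linarith), h, ?_⟩
            show x.2 < c - |x.1|
            linarith
          have e2 := phif_e2_pos (δ := δ) hc x h
          rw [indicator_of_mem hmem (fun _ : ℝ × ℝ => 2 / c ^ 2)]
          have : 2 / c ^ 2 = 1 / c ^ 2 + 1 / c ^ 2 := by ring
          linarith
  refine hle.trans (le_of_eq ?_)
  rw [integral_add iL iW, integral_indicator mL, integral_indicator mW, setIntegral_const,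
    setIntegral_const, Measure.real, Measure.real, vL, vW, ENNReal.toReal_ofReal hc.le,
    ENNReal.toReal_ofReal (by positivity)]
  simp only [smul_eq_mul]
  field_simp
  ring

lemma phif_axis {c δ : ℝ} (hc : 0 < c) (hδ : 0 < δ) :
    c - 2 * c * δ ≤ ∫ x : ℝ, phif c δ (x, 0) := by
  obtain ⟨C, hC⟩ := phif_lip (δ := δ) hc
  have hi := axis_integrable hC.continuous (phif_supp hc hδ).1
  have h1 : ∫ x in Ioo (-c) c, phif c δ (x, 0) ≤ ∫ x : ℝ, phif c δ (x, 0) :=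
    setIntegral_le_integral hi (.of_forall fun x => le_max_right _ _)
  refine le_trans ?_ h1
  have h2 := integral_tent hc (1 - δ) (1 / c)
  rw [show 2 * c * (1 - δ) - 1 / c * c ^ 2 = c - 2 * c * δ by field_simp; ring] at h2
  rw [← h2]
  apply setIntegral_mono
  · exact ((show Continuous fun x : ℝ => 1 - δ - 1 / c * |x| by fun_prop).integrableOn_Icc
      (a := -c) (b := c)).mono_set Ioo_subset_Icc_self
  · exact hi.integrableOn
  · intro x
    refine le_trans (le_of_eq ?_) (le_max_left _ _)
    simp [psif]
    ring

lemma main_bound_s7 {c : ℝ} (hc : 0 < c) {u : ℝ × ℝ → ℝ} (hu : DirichletSol (triangleA c) u)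
    {t : ℝ} (ht : 0 ≤ t) : 2 * t * c ≤ (∫ x : ℝ, u (x, 0)) + t ^ 2 * (c + 1 / c + 2) := by
  have key : ∀ δ > (0:ℝ), 2 * t * (c - 2 * c * δ) ≤
      (∫ x : ℝ, u (x, 0)) + t ^ 2 * (c + 1 / c + 2) := by
    intro δ hδ
    obtain ⟨C, hC⟩ := phif_lip (δ := δ) hc
    obtain ⟨s1, s2⟩ := phif_supp hc hδ
    have h := energy_ineq hc hu hC s1 s2 t
    have h1 := mul_le_mul_of_nonneg_left (phif_axis hc hδ) (show 0 ≤ 2 * t by linarith)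
    have h2 := mul_le_mul_of_nonneg_left (phif_energy hc hδ) (sq_nonneg t)
    linarith
  have hl : Tendsto (fun δ : ℝ => 2 * t * (c - 2 * c * δ)) (𝓝[>] 0) (𝓝 (2 * t * c)) := by
    have : Continuous (fun δ : ℝ => 2 * t * (c - 2 * c * δ)) := by fun_prop
    have := this.tendsto 0
    simp only [mul_zero, sub_zero] at this
    exact this.mono_left nhdsWithin_le_nhds
  refine le_of_tendsto hl ?_
  filter_upwards [self_mem_nhdsWithin] with δ hδ using key δ hδ

/-- Initial estimate: `F(A_c, u) ≤ 2` for any solution `u` of the Dirichlet problem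
associated with the triangle `A_c`, i.e. `∫ u(x₁,0) dx₁ ≥ c − 2`. -/
theorem Ffun_triangle_le_two (c : ℝ) (hc : 0 < c)
    (u : ℝ × ℝ → ℝ) (hu : DirichletSol (triangleA c) u) :
    Ffun (triangleA c) u ≤ 2 := by
  rw [Ffun, vol_tri hc, ENNReal.toReal_ofReal hc.le]
  have h := main_bound_s7 hc hu (t := c ^ 2 / (c + 1) ^ 2) (by positivity)
  have e : (c ^ 2 / (c + 1) ^ 2) ^ 2 * (c + 1 / c + 2) = c ^ 3 / (c + 1) ^ 2 := by
    field_simp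
    ring
  have e2 : 2 * (c ^ 2 / (c + 1) ^ 2) * c = 2 * (c ^ 3 / (c + 1) ^ 2) := by ring
  rw [e, e2] at h
  have h3 : c - 2 ≤ c ^ 3 / (c + 1) ^ 2 := by
    rw [le_div_iff₀ (by positivity)]
    nlinarith
  linarith
end
end

section
/- Let l ∈ (π, 2π) and let Ω = {(r cos α, r sin α) : r > 0, π/2 − l/2 < α < π/2 + l/2} be the open sector of aperture l bisected by the positive x₂-axis (note Ω contains the punctured closed upper half-plane). Let v(x) = max(x₂, 0). Then there exist R > 0 and a Lipschitz function w : ℝ² → ℝ with w(x₁, x₂) = w(−x₁, x₂) for all (x₁, x₂) and with w = v on Ω ∖ B_R (B_R the open ball of radius R centered at the origin), such that ∫_{Ω ∩ B_R} ‖∇w‖² dx + |{w > 0} ∩ Ω ∩ B_R| < ∫_{Ω ∩ B_R} ‖∇v‖² dx + |{v > 0} ∩ Ω ∩ B_R|, where ∇ denotes the almost-everywhere defined Fréchet derivative and |·| Lebesgue measure. -/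
open MeasureTheory Set

noncomputable section

/-- Square of the Euclidean norm of the a.e.-defined gradient of `w : ℝ² → ℝ`,
computed from the Fréchet derivative (Lean's `fderiv` is `0` where `w` is not
differentiable, a null set for Lipschitz `w` by Rademacher's theorem). -/
def gradSq (w : ℝ × ℝ → ℝ) (x : ℝ × ℝ) : ℝ :=
  (fderiv ℝ w x (1, 0)) ^ 2 + (fderiv ℝ w x (0, 1)) ^ 2

/-- The open Euclidean ball of radius `R` centered at the origin of `ℝ²`. -/
def euclBall (R : ℝ) : Set (ℝ × ℝ) := {x : ℝ × ℝ | x.1 ^ 2 + x.2 ^ 2 < R ^ 2}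

/-- The open sector of aperture `l` bisected by the positive `x₂`-axis. -/
def sector (l : ℝ) : Set (ℝ × ℝ) :=
  {x : ℝ × ℝ | ∃ r > (0:ℝ), ∃ α : ℝ, Real.pi / 2 - l / 2 < α ∧ α < Real.pi / 2 + l / 2 ∧
    x = (r * Real.cos α, r * Real.sin α)}

/-- The one-phase Alt–Caffarelli functional `J(w, S) = ∫_S ‖∇w‖² + |{w > 0} ∩ S|`. -/
def Jone (S : Set (ℝ × ℝ)) (w : ℝ × ℝ → ℝ) : ℝ :=
  (∫ x in S, gradSq w x) + (volume ({x : ℝ × ℝ | 0 < w x} ∩ S)).toReal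


open Filter Topology

lemma sector_eq (l : ℝ) (hl : l ∈ Set.Ioo Real.pi (2 * Real.pi)) :
    sector l = {x : ℝ × ℝ | Real.cos (l / 2) * √(x.1 ^ 2 + x.2 ^ 2) < x.2} := by
  have hpi := Real.pi_pos
  obtain ⟨h1, h2⟩ := hl
  ext x
  constructor
  · rintro ⟨r, hr, α, ha1, ha2, rfl⟩
    have hs : √((r * Real.cos α) ^ 2 + (r * Real.sin α) ^ 2) = r := by
      rw [show (r * Real.cos α) ^ 2 + (r * Real.sin α) ^ 2 = r ^ 2 by
        linear_combination r ^ 2 * Real.sin_sq_add_cos_sq α]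
      exact Real.sqrt_sq hr.le
    simp only [mem_setOf_eq, hs]
    have hab : |α - Real.pi / 2| < l / 2 := by rw [abs_lt]; constructor <;> linarith
    have hc : Real.cos (l / 2) < Real.cos |α - Real.pi / 2| :=
      Real.cos_lt_cos_of_nonneg_of_le_pi (abs_nonneg _) (by linarith) hab
    rw [Real.cos_abs, Real.cos_sub_pi_div_two] at hc
    nlinarith
  · intro hx
    simp only [mem_setOf_eq] at hx
    have hr : 0 < √(x.1 ^ 2 + x.2 ^ 2) := by
      rcases (Real.sqrt_nonneg (x.1 ^ 2 + x.2 ^ 2)).lt_or_eq with h | h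
      · exact h
      · exfalso
        have h0 := (Real.sqrt_eq_zero (by positivity)).1 h.symm
        have : x.2 = 0 := by nlinarith [sq_nonneg x.1, sq_nonneg x.2]
        rw [← h, this] at hx
        simp at hx
    set r := √(x.1 ^ 2 + x.2 ^ 2) with hrdef
    let z : ℂ := ⟨x.2, -x.1⟩
    have hz : ‖z‖ = r := by
      rw [Complex.norm_def, Complex.normSq_apply, hrdef]
      congr 1
      simp only [z]; ring
    have hz0 : z ≠ 0 := by
      intro h
      rw [h] at hz
      simp at hz
      linarith
    have hcos := Complex.cos_arg hz0
    have hsin := Complex.sin_arg z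
    rw [hz] at hcos hsin
    simp only [z] at hcos hsin
    have hlt : |Complex.arg z| < l / 2 := by
      by_contra hcon
      push Not at hcon
      have := Real.cos_le_cos_of_nonneg_of_le_pi (by linarith) (Complex.abs_arg_le_pi z) hcon
      rw [Real.cos_abs, hcos, div_le_iff₀ hr] at this
      linarith
    rw [abs_lt] at hlt
    refine ⟨r, hr, Complex.arg z + Real.pi / 2, by linarith, by linarith, ?_⟩
    rw [Real.cos_add_pi_div_two, Real.sin_add_pi_div_two, hcos, hsin]
    ext
    · simp; field_simp
    · simp; field_simp

/-- logarithmic cutoff -/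
def phi (L : ℝ) (x : ℝ × ℝ) : ℝ := max (1 - Real.log (max ‖x‖ 1) / L) 0

lemma log_diff {a b c : ℝ} (hc : 0 < c) (ha : c ≤ a) (hb : c ≤ b) :
    |Real.log a - Real.log b| ≤ c⁻¹ * |a - b| := by
  have key : ∀ a b : ℝ, c ≤ a → c ≤ b → Real.log a - Real.log b ≤ c⁻¹ * |a - b| := by
    intro a b ha hb
    have ha0 : 0 < a := hc.trans_le ha
    have hb0 : 0 < b := hc.trans_le hb
    rw [← Real.log_div ha0.ne' hb0.ne']
    calc Real.log (a / b) ≤ a / b - 1 := Real.log_le_sub_one_of_pos (by positivity)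
      _ = b⁻¹ * (a - b) := by field_simp
      _ ≤ b⁻¹ * |a - b| := by gcongr; exact le_abs_self _
      _ ≤ c⁻¹ * |a - b| := by gcongr
  rw [abs_le]
  have h1 := key a b ha hb
  have h2 := key b a hb ha
  rw [abs_sub_comm] at h2
  constructor <;> linarith

lemma phi_diff {L c : ℝ} (hL : 0 < L) (hc : 0 < c) (x y : ℝ × ℝ) (hx : c ≤ max ‖x‖ 1)
    (hy : c ≤ max ‖y‖ 1) : |phi L x - phi L y| ≤ (c * L)⁻¹ * ‖x - y‖ := by
  unfold phi
  calc _ ≤ |(1 - Real.log (max ‖x‖ 1) / L) - (1 - Real.log (max ‖y‖ 1) / L)| :=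
        abs_max_sub_max_le_abs _ _ _
    _ = L⁻¹ * |Real.log (max ‖x‖ 1) - Real.log (max ‖y‖ 1)| := by
        rw [show (1 - Real.log (max ‖x‖ 1) / L) - (1 - Real.log (max ‖y‖ 1) / L)
          = - (L⁻¹ * (Real.log (max ‖x‖ 1) - Real.log (max ‖y‖ 1))) by field_simp; ring,
          abs_neg, abs_mul, abs_of_pos (inv_pos.2 hL)]
    _ ≤ L⁻¹ * (c⁻¹ * |max ‖x‖ 1 - max ‖y‖ 1|) := by
        gcongr
        exact log_diff hc hx hy
    _ ≤ L⁻¹ * (c⁻¹ * ‖x - y‖) := by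
        gcongr
        exact (abs_max_sub_max_le_abs _ _ _).trans (abs_norm_sub_norm_le _ _)
    _ = _ := by rw [mul_inv]; ring

lemma phi_lip {L : ℝ} (hL : 0 < L) : LipschitzWith (L⁻¹).toNNReal (phi L) := by
  refine LipschitzWith.of_dist_le_mul fun x y => ?_
  rw [Real.dist_eq, dist_eq_norm, Real.coe_toNNReal _ (by positivity)]
  simpa using phi_diff hL one_pos x y (le_max_right _ _) (le_max_right _ _)

lemma phi_one {L : ℝ} (x : ℝ × ℝ) (hx : ‖x‖ ≤ 1) : phi L x = 1 := by
  simp [phi, max_eq_right hx]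

lemma phi_zero {L : ℝ} (hL : 0 < L) (x : ℝ × ℝ) (hx : Real.exp L ≤ ‖x‖) : phi L x = 0 := by
  have h1 : 1 ≤ ‖x‖ := (Real.one_le_exp hL.le).trans hx
  have h2 : L ≤ Real.log ‖x‖ := (Real.le_log_iff_exp_le (by linarith)).2 hx
  unfold phi
  rw [max_eq_left h1]
  apply max_eq_right
  have : 1 ≤ Real.log ‖x‖ / L := by rwa [le_div_iff₀ hL, one_mul]
  linarith

lemma gradSq_le {f : ℝ × ℝ → ℝ} {x : ℝ × ℝ} {C : ℝ} (h : ‖fderiv ℝ f x‖ ≤ C) :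
    gradSq f x ≤ 2 * C ^ 2 := by
  have h1 := (fderiv ℝ f x).le_of_opNorm_le h (1, 0)
  have h2 := (fderiv ℝ f x).le_of_opNorm_le h (0, 1)
  simp [Prod.norm_def] at h1 h2
  unfold gradSq
  have h3 := sq_le_sq' (abs_le.1 h1).1 (abs_le.1 h1).2
  have h4 := sq_le_sq' (abs_le.1 h2).1 (abs_le.1 h2).2
  linarith

/-- radial bound -/
def gb (L : ℝ) (y : ℝ) : ℝ := (Icc 1 (Real.exp L)).indicator (fun y => 8 / L ^ 2 * (y ^ 2)⁻¹) y

lemma gb_nonneg (L y : ℝ) : 0 ≤ gb L y := by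
  unfold gb
  apply indicator_nonneg
  intro y _; positivity

lemma phi_grad {L : ℝ} (hL : 0 < L) (x : ℝ × ℝ) : gradSq (phi L) x ≤ gb L ‖x‖ := by
  by_cases hx : ‖x‖ ∈ Icc 1 (Real.exp L)
  · rw [gb, indicator_of_mem hx]
    have hp : 0 < ‖x‖ := one_pos.trans_le hx.1
    have : ‖fderiv ℝ (phi L) x‖ ≤ (‖x‖ / 2 * L)⁻¹ := by
      apply norm_fderiv_le_of_lip' ℝ (by positivity)
      have : ∀ᶠ y in 𝓝 x, ‖x‖ / 2 < ‖y‖ :=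
        continuous_norm.continuousAt.eventually (lt_mem_nhds (by linarith))
      filter_upwards [this] with y hy
      exact phi_diff hL (by positivity) y x (hy.le.trans (le_max_left _ _))
        ((by linarith : ‖x‖ / 2 ≤ ‖x‖).trans (le_max_left _ _))
    refine (gradSq_le this).trans (le_of_eq ?_)
    field_simp
    norm_num
  · rw [gb, indicator_of_notMem hx]
    have hcases : ‖x‖ < 1 ∨ Real.exp L < ‖x‖ := by
      by_contra hcon
      push Not at hcon
      exact hx hcon
    have : fderiv ℝ (phi L) x = 0 := by
      rcases hcases with h | h
      · have : phi L =ᶠ[𝓝 x] fun _ => 1 := by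
          filter_upwards [continuous_norm.continuousAt.eventually (gt_mem_nhds h)] with y hy
          exact phi_one y hy.le
        rw [this.fderiv_eq]; simp
      · have : phi L =ᶠ[𝓝 x] fun _ => 0 := by
          filter_upwards [continuous_norm.continuousAt.eventually (lt_mem_nhds h)] with y hy
          exact phi_zero hL y hy.le
        rw [this.fderiv_eq]; simp
    simp [gradSq, this]

lemma gb_int_aux {L : ℝ} (hL : 0 < L) :
    (fun y : ℝ => y ^ (Module.finrank ℝ (ℝ × ℝ) - 1) • gb L y)
      = (Icc 1 (Real.exp L)).indicator (fun y => 8 / L ^ 2 * y⁻¹) := by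
  funext y
  simp only [Module.finrank_prod, Module.finrank_self, gb]
  by_cases hy : y ∈ Icc 1 (Real.exp L)
  · have : y ≠ 0 := by have := hy.1; linarith
    simp only [indicator_of_mem hy, smul_eq_mul]
    field_simp
    norm_num
  · simp [indicator_of_notMem hy]

lemma gb_integrable {L : ℝ} (hL : 0 < L) : Integrable (fun x : ℝ × ℝ => gb L ‖x‖) := by
  rw [MeasureTheory.integrable_fun_norm_addHaar (volume : Measure (ℝ × ℝ)) (f := gb L),
    gb_int_aux hL]
  apply Integrable.integrableOn
  rw [integrable_indicator_iff measurableSet_Icc]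
  apply ContinuousOn.integrableOn_Icc
  apply ContinuousOn.mul continuousOn_const
  apply ContinuousOn.inv₀ continuousOn_id
  intro y hy
  have := hy.1
  simp only [id]; linarith

lemma gb_integral {L : ℝ} (hL : 0 < L) : ∫ x : ℝ × ℝ, gb L ‖x‖ = 64 / L := by
  rw [MeasureTheory.integral_fun_norm_addHaar (volume : Measure (ℝ × ℝ)) (gb L), gb_int_aux hL]
  have hb : (volume : Measure (ℝ × ℝ)).real (Metric.ball 0 1) = 4 := by
    rw [show (0 : ℝ × ℝ) = (0, 0) from rfl, ← ball_prod_same, Measure.volume_eq_prod,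
      measureReal_prod_prod]
    simp [Measure.real, Real.volume_ball]
    norm_num
  rw [hb, setIntegral_indicator measurableSet_Icc,
    show Ioi 0 ∩ Icc 1 (Real.exp L) = Icc 1 (Real.exp L) from
      inter_eq_right.2 fun y hy => one_pos.trans_le hy.1,
    integral_Icc_eq_integral_Ioc,
    ← intervalIntegral.integral_of_le (Real.one_le_exp hL.le), intervalIntegral.integral_const_mul,
    integral_inv_of_pos one_pos (Real.exp_pos L)]
  simp
  field_simp
  norm_num

lemma euclBall_open (R : ℝ) : IsOpen (euclBall R) :=
  isOpen_lt (by fun_prop) (by fun_prop)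

lemma mem_euclBall_of_norm {R : ℝ} {x : ℝ × ℝ} (hR : 0 < R) (hx : ‖x‖ ≤ R) :
    x ∈ euclBall (2 * R) := by
  have h1 : |x.1| ≤ R := (norm_fst_le x).trans hx
  have h2 : |x.2| ≤ R := (norm_snd_le x).trans hx
  have h3 := sq_le_sq' (abs_le.1 h1).1 (abs_le.1 h1).2
  have h4 := sq_le_sq' (abs_le.1 h2).1 (abs_le.1 h2).2
  simp only [euclBall, mem_setOf_eq]
  nlinarith

lemma euclBall_fin {R : ℝ} (hR : 0 < R) : volume (euclBall R) < ⊤ := by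
  refine (measure_mono (t := Metric.closedBall 0 R) ?_).trans_lt measure_closedBall_lt_top
  intro x hx
  simp only [euclBall, mem_setOf_eq] at hx
  rw [mem_closedBall_zero_iff, Prod.norm_def, max_le_iff]
  constructor
  · exact abs_le_of_sq_le_sq (by nlinarith [sq_nonneg x.2]) hR.le
  · exact abs_le_of_sq_le_sq (by nlinarith [sq_nonneg x.1]) hR.le

/-- energy density -/
def Fd (w : ℝ × ℝ → ℝ) (x : ℝ × ℝ) : ℝ :=
  gradSq w x + {x : ℝ × ℝ | 0 < w x}.indicator (fun _ => (1 : ℝ)) x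

lemma gradSq_nonneg (w : ℝ × ℝ → ℝ) (x : ℝ × ℝ) : 0 ≤ gradSq w x := by
  unfold gradSq; positivity

lemma gradSq_intOn {w : ℝ × ℝ → ℝ} {K : NNReal} (hw : LipschitzWith K w) {S : Set (ℝ × ℝ)}
    (hS : volume S < ⊤) : IntegrableOn (gradSq w) S := by
  refine Measure.integrableOn_of_bounded (M := 2 * (K : ℝ) ^ 2) hS.ne ?_ ?_
  · apply Measurable.aestronglyMeasurable
    exact ((measurable_fderiv_apply_const ℝ w (1, 0)).pow_const 2).add
      ((measurable_fderiv_apply_const ℝ w (0, 1)).pow_const 2)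
  · refine Eventually.of_forall fun x => ?_
    rw [Real.norm_of_nonneg (gradSq_nonneg w x)]
    exact gradSq_le (norm_fderiv_le_of_lipschitz ℝ hw)

lemma pos_open {w : ℝ × ℝ → ℝ} {K : NNReal} (hw : LipschitzWith K w) :
    IsOpen {x : ℝ × ℝ | 0 < w x} := isOpen_lt continuous_const hw.continuous

lemma ind_intOn {w : ℝ × ℝ → ℝ} {K : NNReal} (hw : LipschitzWith K w) {S : Set (ℝ × ℝ)}
    (hS : volume S < ⊤) :
    IntegrableOn ({x : ℝ × ℝ | 0 < w x}.indicator (fun _ => (1 : ℝ))) S :=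
  (integrableOn_const hS.ne).indicator (pos_open hw).measurableSet

lemma Fd_intOn {w : ℝ × ℝ → ℝ} {K : NNReal} (hw : LipschitzWith K w) {S : Set (ℝ × ℝ)}
    (hS : volume S < ⊤) : IntegrableOn (Fd w) S :=
  (gradSq_intOn hw hS).add (ind_intOn hw hS)

lemma Jone_eq {w : ℝ × ℝ → ℝ} {K : NNReal} (hw : LipschitzWith K w) {S : Set (ℝ × ℝ)}
    (hS : volume S < ⊤) : Jone S w = ∫ x in S, Fd w x := by
  unfold Jone Fd
  rw [integral_add (gradSq_intOn hw hS) (ind_intOn hw hS),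
    integral_indicator (pos_open hw).measurableSet,
    Measure.restrict_restrict (pos_open hw).measurableSet]
  simp [Measure.real]

lemma fderiv_of_nonpos (u : ℝ × ℝ → ℝ) (x : ℝ × ℝ) (hx : u x ≤ 0) :
    fderiv ℝ (fun y => max (u y) 0) x = 0 := by
  apply IsLocalMin.fderiv_eq_zero
  refine Eventually.of_forall fun y => ?_
  simp [max_eq_right hx]

lemma fderiv_of_pos (u : ℝ × ℝ → ℝ) (hu : Continuous u) (x : ℝ × ℝ) (hx : 0 < u x) :
    fderiv ℝ (fun y => max (u y) 0) x = fderiv ℝ u x := by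
  apply Filter.EventuallyEq.fderiv_eq
  filter_upwards [hu.continuousAt.eventually (lt_mem_nhds hx)] with y hy
  exact max_eq_left hy.le

/-- The one-phase density identity, as an inequality. -/
lemma Fd_le (f : ℝ × ℝ → ℝ) (hf : Continuous f) (x : ℝ × ℝ) (hd : DifferentiableAt ℝ f x) :
    Fd (fun y => max (y.2 + f y) 0) x
      ≤ 2 * fderiv ℝ (fun y : ℝ × ℝ => max (y.2 + f y) 0) x (0, 1) + gradSq f x := by
  by_cases hx : 0 < x.2 + f x
  · have h1 := fderiv_of_pos (fun y : ℝ × ℝ => y.2 + f y) (by fun_prop) x hx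
    have h2 : fderiv ℝ (fun y : ℝ × ℝ => y.2 + f y) x
        = ContinuousLinearMap.snd ℝ ℝ ℝ + fderiv ℝ f x := by
      rw [fderiv_fun_add differentiableAt_snd hd, fderiv_snd]
    rw [Fd, indicator_of_mem (by simpa using hx), gradSq, gradSq, h1, h2]
    simp
    nlinarith
  · have h1 := fderiv_of_nonpos (fun y : ℝ × ℝ => y.2 + f y) x (not_lt.1 hx)
    rw [Fd, indicator_of_notMem (by simpa using hx), gradSq, h1]
    simpa using gradSq_nonneg f x

lemma Fd_v (x : ℝ × ℝ) : Fd (fun y => max y.2 0) x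
      = 2 * fderiv ℝ (fun y : ℝ × ℝ => max y.2 0) x (0, 1) := by
  by_cases hx : 0 < x.2
  · have h1 := fderiv_of_pos (fun y : ℝ × ℝ => y.2) (by fun_prop) x hx
    rw [Fd, indicator_of_mem (by simpa using hx), gradSq, h1, fderiv_snd]
    simp
    norm_num
  · have h1 := fderiv_of_nonpos (fun y : ℝ × ℝ => y.2) x (not_lt.1 hx)
    rw [Fd, indicator_of_notMem (by simpa using hx), gradSq, h1]
    simp

lemma Fd_v_zero (x : ℝ × ℝ) (hx : x.2 ≤ 0) : Fd (fun y => max y.2 0) x = 0 := by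
  rw [Fd_v, fderiv_of_nonpos (fun y : ℝ × ℝ => y.2) x hx]
  simp

lemma Fd_nonneg (w : ℝ × ℝ → ℝ) (x : ℝ × ℝ) : 0 ≤ Fd w x :=
  add_nonneg (gradSq_nonneg w x) (indicator_nonneg (fun _ _ => zero_le_one) x)

lemma v_lip : LipschitzWith 1 (fun y : ℝ × ℝ => max y.2 0) :=
  LipschitzWith.prod_snd.max_const 0

/-- Total energy comparison on the whole ball. -/
lemma ball_compare {L : ℝ} (hL : 0 < L) {K : NNReal}
    (hw : LipschitzWith K (fun y : ℝ × ℝ => max (y.2 + phi L y) 0)) :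
    ∫ x in euclBall (2 * Real.exp L), Fd (fun y : ℝ × ℝ => max (y.2 + phi L y) 0) x
      ≤ (∫ x in euclBall (2 * Real.exp L), Fd (fun y : ℝ × ℝ => max y.2 0) x) + 64 / L := by
  set w := fun y : ℝ × ℝ => max (y.2 + phi L y) 0 with hwdef
  set v := fun y : ℝ × ℝ => max y.2 0 with hvdef
  set B := euclBall (2 * Real.exp L) with hB
  have hR := Real.exp_pos L
  have hBf : volume B < ⊤ := euclBall_fin (by positivity)
  have hD : LipschitzWith (K + 1) (fun y => w y - v y) := hw.sub v_lip
  have hD0 : ∀ x, Real.exp L ≤ ‖x‖ → w x - v x = 0 := by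
    intro x hx
    simp [hwdef, hvdef, phi_zero hL x hx]
  have hcs : HasCompactSupport (fun y => w y - v y) := by
    apply HasCompactSupport.intro (isCompact_closedBall (0 : ℝ × ℝ) (Real.exp L))
    intro x hx
    apply hD0
    rw [mem_closedBall_zero_iff] at hx
    exact (not_le.1 hx).le
  have hint : ∫ x, lineDeriv ℝ (fun y => w y - v y) x (0, 1) = 0 := by
    have := LipschitzWith.integral_lineDeriv_mul_eq (μ := (volume : Measure (ℝ × ℝ)))
      (LipschitzWith.const (1 : ℝ)) hD hcs (-(0, 1))
    have hlc : ∀ x u : ℝ × ℝ, lineDeriv ℝ (fun _ : ℝ × ℝ => (1 : ℝ)) x u = 0 := by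
      intro x u; simp [lineDeriv]
    simp only [hlc, neg_neg, mul_one, zero_mul, integral_zero] at this
    exact this.symm
  have hintB : ∫ x in B, lineDeriv ℝ (fun y => w y - v y) x (0, 1) = 0 := by
    rw [setIntegral_eq_integral_of_forall_compl_eq_zero, hint]
    intro x hx
    have hxn : Real.exp L < ‖x‖ := by
      by_contra hcon
      exact hx (mem_euclBall_of_norm hR (not_lt.1 hcon))
    have : (fun y => w y - v y) =ᶠ[𝓝 x] fun _ => 0 := by
      filter_upwards [continuous_norm.continuousAt.eventually (lt_mem_nhds hxn)] with y hy
      exact hD0 y hy.le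
    rw [this.lineDeriv_eq]; simp [lineDeriv]
  have hintD : IntegrableOn (fun x => lineDeriv ℝ (fun y => w y - v y) x (0, 1)) B := by
    refine Measure.integrableOn_of_bounded (M := ((K + 1 : NNReal) : ℝ) * ‖((0, 1) : ℝ × ℝ)‖) hBf.ne
      (aestronglyMeasurable_lineDeriv hD.continuous _) ?_
    exact Eventually.of_forall fun x => norm_lineDeriv_le_of_lipschitz ℝ hD
  have hae : ∀ᵐ x ∂(volume : Measure (ℝ × ℝ)), Fd w x
      ≤ Fd v x + 2 * lineDeriv ℝ (fun y => w y - v y) x (0, 1) + gb L ‖x‖ := by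
    filter_upwards [hw.ae_differentiableAt, v_lip.ae_differentiableAt,
      (phi_lip hL).ae_differentiableAt] with x h1 h2 h3
    rw [(h1.sub h2).lineDeriv_eq_fderiv (f := fun y => w y - v y), fderiv_fun_sub h1 h2]
    have e1 := Fd_le (phi L) (phi_lip hL).continuous x h3
    have e2 := Fd_v x
    have e3 := phi_grad hL x
    simp only [ContinuousLinearMap.sub_apply]
    simp only [← hwdef, ← hvdef] at e1 e2
    linarith
  have hFv := Fd_intOn v_lip hBf
  have hg : IntegrableOn (fun x : ℝ × ℝ => gb L ‖x‖) B := (gb_integrable hL).integrableOn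
  calc ∫ x in B, Fd w x
      ≤ ∫ x in B, (Fd v x + 2 * lineDeriv ℝ (fun y => w y - v y) x (0, 1) + gb L ‖x‖) :=
        integral_mono_ae (Fd_intOn hw hBf) ((hFv.add (hintD.const_mul 2)).add hg)
          (ae_restrict_of_ae hae)
    _ = (∫ x in B, Fd v x) + ∫ x in B, gb L ‖x‖ := by
        have hFv2 : IntegrableOn (fun x => Fd v x) B := hFv
        have h12 : IntegrableOn
            (fun x => Fd v x + 2 * lineDeriv ℝ (fun y => w y - v y) x (0, 1)) B :=
          hFv2.add (hintD.const_mul 2)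
        rw [integral_add h12 hg, integral_add hFv2 (hintD.const_mul 2), integral_const_mul, hintB]
        simp
    _ ≤ _ := by
        rw [← gb_integral hL]
        refine add_le_add le_rfl ?_
        exact setIntegral_le_integral (gb_integrable hL)
          (Eventually.of_forall fun x => gb_nonneg L _)

/-- On a sector `Ω` of aperture `l ∈ (π, 2π)`, the linear profile `v = x₂⁺` is not a
one-phase minimizer: there is a symmetric Lipschitz competitor `w` agreeing with `v`
on `Ω ∖ B_R` with strictly smaller energy on `Ω ∩ B_R`. -/
theorem linear_profile_not_minimal (l : ℝ) (hl : l ∈ Set.Ioo Real.pi (2 * Real.pi)) :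
    ∃ R > (0:ℝ), ∃ w : ℝ × ℝ → ℝ, ∃ K : NNReal, LipschitzWith K w ∧
      (∀ x : ℝ × ℝ, w (x.1, x.2) = w (-x.1, x.2)) ∧
      (∀ x ∈ sector l \ euclBall R, w x = max x.2 0) ∧
      Jone (sector l ∩ euclBall R) w
        < Jone (sector l ∩ euclBall R) (fun x : ℝ × ℝ => max x.2 0) := by
  have hsec := sector_eq l hl
  have hpi := Real.pi_pos
  have hc0 : Real.cos (l / 2) < 0 :=
    Real.cos_neg_of_pi_div_two_lt_of_lt (by linarith [hl.1]) (by linarith [hl.2])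
  have hc1 : -1 < Real.cos (l / 2) := by
    rw [← Real.cos_pi]
    exact Real.cos_lt_cos_of_nonneg_of_le_pi (by linarith [hl.1]) le_rfl (by linarith [hl.2])
  have hopen : IsOpen (sector l) := by
    rw [hsec]
    exact isOpen_lt (by fun_prop) (by fun_prop)
  have hup : ∀ x : ℝ × ℝ, x ∉ sector l → x.2 ≤ 0 := by
    intro x hx
    by_contra hcon
    apply hx
    rw [hsec]
    simp only [mem_setOf_eq]
    nlinarith [Real.sqrt_nonneg (x.1 ^ 2 + x.2 ^ 2)]
  -- the gained region
  let T : Set (ℝ × ℝ) := {x | x.2 < Real.cos (l / 2) * √(x.1 ^ 2 + x.2 ^ 2)} ∩ Metric.ball 0 1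
  have hTo : IsOpen T := (isOpen_lt (by fun_prop) (by fun_prop)).inter Metric.isOpen_ball
  have hTne : T.Nonempty := by
    refine ⟨(0, -(1 / 2)), ?_, ?_⟩
    · simp only [mem_setOf_eq]
      rw [show ((0 : ℝ) ^ 2 + (-(1 / 2)) ^ 2) = (1 / 2) ^ 2 by norm_num,
        Real.sqrt_sq (by norm_num)]
      linarith
    · rw [mem_ball_zero_iff, Prod.norm_def]
      norm_num [Real.norm_eq_abs, abs_of_nonneg]
  have hTfin : volume T < ⊤ := (measure_mono inter_subset_right).trans_lt measure_ball_lt_top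
  have hTpos : 0 < volume.real T :=
    ENNReal.toReal_pos (hTo.measure_pos volume hTne).ne' hTfin.ne
  set m := volume.real T with hm
  let L : ℝ := 65 / m
  have hL : 0 < L := by positivity
  have hLm : 64 / L < m := by
    simp only [L]
    rw [div_div_eq_mul_div, div_lt_iff₀ (by norm_num)]
    linarith
  have hR := Real.exp_pos L
  have hw : LipschitzWith (1 + (L⁻¹).toNNReal) (fun y : ℝ × ℝ => max (y.2 + phi L y) 0) :=
    (LipschitzWith.prod_snd.add (phi_lip hL)).max_const 0
  refine ⟨2 * Real.exp L, by positivity, fun y => max (y.2 + phi L y) 0, _, hw, ?_, ?_, ?_⟩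
  · intro x
    simp [phi, Prod.norm_def]
  · rintro x ⟨-, hx⟩
    have : Real.exp L ≤ ‖x‖ := by
      by_contra hcon
      exact hx (mem_euclBall_of_norm hR (not_le.1 hcon).le)
    simp [phi_zero hL x this]
  · have hcmp := ball_compare hL hw
    set w := fun y : ℝ × ℝ => max (y.2 + phi L y) 0 with hwdef
    set B := euclBall (2 * Real.exp L) with hB
    have hBf : volume B < ⊤ := euclBall_fin (by positivity)
    have hSf : volume (sector l ∩ B) < ⊤ := (measure_mono inter_subset_right).trans_lt hBf
    rw [Jone_eq hw hSf, Jone_eq v_lip hSf]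
    have hsplit := integral_inter_add_diff (μ := volume) (s := B) hopen.measurableSet
      (Fd_intOn hw hBf)
    have hsplitv := integral_inter_add_diff (μ := volume) (s := B) hopen.measurableSet
      (Fd_intOn v_lip hBf)
    rw [inter_comm] at hsplit hsplitv
    have hv0 : ∫ x in B \ sector l, Fd (fun y : ℝ × ℝ => max y.2 0) x = 0 := by
      apply setIntegral_eq_zero_of_forall_eq_zero
      intro x hx
      exact Fd_v_zero x (hup x hx.2)
    have hTsub : T ⊆ B \ sector l := by
      rintro x ⟨h1, h2⟩
      rw [mem_ball_zero_iff] at h2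
      refine ⟨mem_euclBall_of_norm hR (h2.le.trans (Real.one_le_exp hL.le)), ?_⟩
      rw [hsec]
      simp only [mem_setOf_eq] at h1 ⊢
      exact not_lt.2 h1.le
    have hgain : m ≤ ∫ x in B \ sector l, Fd w x := by
      have hint : IntegrableOn (Fd w) (B \ sector l) := (Fd_intOn hw hBf).mono_set diff_subset
      calc m = ∫ x in T, (1 : ℝ) := by simp [hm]
        _ ≤ ∫ x in T, Fd w x := by
            apply setIntegral_mono_on (integrableOn_const hTfin.ne) (hint.mono_set hTsub)
              hTo.measurableSet
            rintro x ⟨-, h2⟩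
            rw [mem_ball_zero_iff] at h2
            have h3 : |x.2| < 1 := (norm_snd_le x).trans_lt h2
            have h4 : 0 < w x := by
              simp only [hwdef, phi_one x h2.le]
              apply lt_max_of_lt_left
              linarith [(abs_lt.1 h3).1]
            rw [Fd, indicator_of_mem (by exact h4)]
            linarith [gradSq_nonneg w x]
        _ ≤ _ := setIntegral_mono_set hint
            (Eventually.of_forall fun x => Fd_nonneg w x) hTsub.eventuallyLE
    linarith
end
end
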